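/- arXiv:2012.02872 — 3 statements merged into one kernel-verified Lean document; each statement's English description precedes it below -/
import Mathlib

section
/- Let d ≥ 1, let B ⊊ ℝ^d be a closed ball, and let f : ℝ^d → ℂ be a measurable function supported in B. Then ∫_B Ψ(x, M(f)(x)) dx < ∞ if and only if ∫_B |f(x)| log⁺ log⁺ |f(x)| dx < ∞. -/
open MeasureTheory Metric ENNReal

/-- `log⁺ s = max (log s) 0`. -/
noncomputable def logPlus (s : ℝ) : ℝ := max (Real.log s) 0

/-- `Ψ(x,t) = t / (log(e+t) + log(e+|x|))`, extended to `t = ∞` (where it equals `∞`). -/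
noncomputable def PsiE {d : ℕ} (x : EuclideanSpace ℝ (Fin d)) (t : ℝ≥0∞) : ℝ≥0∞ :=
  t / ENNReal.ofReal (Real.log (Real.exp 1 + t.toReal) + Real.log (Real.exp 1 + ‖x‖))

/-- The centered Hardy–Littlewood maximal function. -/
noncomputable def maximalFn {d : ℕ} (f : EuclideanSpace ℝ (Fin d) → ℂ)
    (x : EuclideanSpace ℝ (Fin d)) : ℝ≥0∞ :=
  ⨆ (r : ℝ) (_ : 0 < r), (volume (ball x r))⁻¹ * ∫⁻ y in ball x r, (‖f y‖₊ : ℝ≥0∞)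

open Set Filter Topology

section MaximalFunction

variable {d : ℕ}

local notation "𝔼" => EuclideanSpace ℝ (Fin d)

/-- Balls scale like `c ^ d`, whatever their centers. -/
lemma volume_closedBall_mul (x y : 𝔼) {c r : ℝ} (hc : 0 ≤ c) (hr : 0 ≤ r) :
    volume (closedBall x (c * r)) = ENNReal.ofReal (c ^ d) * volume (closedBall y r) := by
  rw [Measure.addHaar_closedBall_mul volume x hc hr, finrank_euclideanSpace_fin,
    Measure.addHaar_closedBall_center volume y r]

/-- Vitali covering lemma for a set whose points are centers of balls of bounded radii. -/
lemma exists_countable_disjoint_closedBall_cover (s : Set 𝔼) (r : 𝔼 → ℝ) (R : ℝ)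
    (hr : ∀ x ∈ s, 0 < r x) (hR : ∀ x ∈ s, r x ≤ R) :
    ∃ u ⊆ s, u.Countable ∧ (u.PairwiseDisjoint fun x => closedBall x (r x)) ∧
      s ⊆ ⋃ x ∈ u, closedBall x (5 * r x) := by
  obtain ⟨u, hus, hdis, hcov⟩ :=
    Vitali.exists_disjoint_subfamily_covering_enlargement_closedBall s (fun x => x) r R hR 5
      (by norm_num)
  refine ⟨u, hus, ?_, hdis, fun x hx => ?_⟩
  · refine hdis.countable_of_nonempty_interior fun x hx => ?_
    exact ⟨x, ball_subset_interior_closedBall (mem_ball_self (hr x (hus hx)))⟩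
  · obtain ⟨b, hb, hsub⟩ := hcov x hx
    exact mem_biUnion hb (hsub (mem_closedBall_self (hr x hx).le))

/-- Weak-type bound: a set covered by balls on which the averages of `g` are at least `a`. -/
lemma mul_volume_le_of_forall_exists_closedBall (hd : 1 ≤ d) {g : 𝔼 → ℝ≥0∞}
    (hgi : ∫⁻ x, g x ≠ ⊤) {s : Set 𝔼} {a : ℝ≥0∞} (ha : a ≠ 0)
    (hs : ∀ x ∈ s, ∃ r : ℝ, 0 < r ∧
      a * volume (closedBall x r) ≤ ∫⁻ y in closedBall x r, g y) :
    a * volume s ≤ ENNReal.ofReal (5 ^ d) * ∫⁻ x, g x := by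
  choose! r hr0 hr using hs
  set V : ℝ≥0∞ := volume (closedBall (0 : 𝔼) 1)
  have hV0 : V ≠ 0 := (measure_closedBall_pos volume _ one_pos).ne'
  have haV : a * V ≠ 0 := mul_ne_zero ha hV0
  have hbound : ∀ x ∈ s, r x ≤ max 1 ((∫⁻ x, g x) / (a * V)).toReal := by
    intro x hx
    rcases le_or_gt (r x) 1 with h1 | h1
    · exact h1.trans (le_max_left _ _)
    refine le_trans ?_ (le_max_right _ _)
    have h2 : ENNReal.ofReal (r x) * (a * V) ≤ ∫⁻ x, g x := by
      calc ENNReal.ofReal (r x) * (a * V) ≤ ENNReal.ofReal (r x ^ d) * (a * V) := by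
            gcongr
            exact le_self_pow₀ h1.le (by omega)
        _ = a * volume (closedBall x (r x)) := by
            have := volume_closedBall_mul x (0 : 𝔼) (hr0 x hx).le zero_le_one
            rw [mul_one] at this
            rw [this]; ring
        _ ≤ ∫⁻ y in closedBall x (r x), g y := hr x hx
        _ ≤ ∫⁻ x, g x := setLIntegral_le_lintegral _ _
    have h3 : ENNReal.ofReal (r x) ≤ (∫⁻ x, g x) / (a * V) :=
      (ENNReal.le_div_iff_mul_le (Or.inl haV) (Or.inr hgi)).2 h2
    exact (ENNReal.ofReal_le_iff_le_toReal (ENNReal.div_lt_top hgi haV).ne).1 h3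
  obtain ⟨u, hus, hcount, hdis, hcov⟩ :=
    exists_countable_disjoint_closedBall_cover s r _ hr0 hbound
  have : Countable u := hcount.to_subtype
  calc a * volume s ≤ a * ∑' x : u, volume (closedBall (x : 𝔼) (5 * r x)) := by
        gcongr
        exact (measure_mono hcov).trans (measure_biUnion_le volume hcount _)
    _ = ENNReal.ofReal (5 ^ d) * ∑' x : u, a * volume (closedBall (x : 𝔼) (r x)) := by
        rw [← ENNReal.tsum_mul_left, ← ENNReal.tsum_mul_left]
        refine tsum_congr fun x => ?_
        rw [volume_closedBall_mul (x : 𝔼) (x : 𝔼) (by norm_num) (hr0 x (hus x.2)).le]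
        ring
    _ ≤ ENNReal.ofReal (5 ^ d) * ∑' x : u, ∫⁻ y in closedBall (x : 𝔼) (r x), g y := by
        gcongr with x
        exact hr x (hus x.2)
    _ = ENNReal.ofReal (5 ^ d) * ∫⁻ y in ⋃ x ∈ u, closedBall (x : 𝔼) (r x), g y := by
        rw [lintegral_biUnion hcount (fun x _ => measurableSet_closedBall) hdis]
    _ ≤ ENNReal.ofReal (5 ^ d) * ∫⁻ x, g x := by
        gcongr
        exact Measure.restrict_le_self

/-- A ball centered in a larger ball meets it in a fixed proportion. -/
lemma volume_closedBall_le_inter {x x₀ : 𝔼} {r R : ℝ} (hr : 0 < r) (hrR : r ≤ R)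
    (hx : x ∈ closedBall x₀ R) :
    volume (closedBall x r) ≤
      ENNReal.ofReal (2 ^ d) * volume (closedBall x₀ R ∩ closedBall x r) := by
  have hR : 0 < R := hr.trans_le hrR
  have hx' : ‖x₀ - x‖ ≤ R := by rw [← dist_eq_norm, dist_comm]; exact hx
  set t : ℝ := r / (2 * R) with ht
  have ht0 : 0 ≤ t := by positivity
  have htR : t * R = r / 2 := by rw [ht]; field_simp
  have ht1 : t ≤ 1 := by rw [ht, div_le_one (by positivity)]; linarith
  set z : 𝔼 := x + t • (x₀ - x) with hz
  have h1 : dist z x ≤ r / 2 := by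
    rw [dist_eq_norm, hz, add_sub_cancel_left, norm_smul, Real.norm_of_nonneg ht0, ← htR]
    gcongr
  have h2 : dist z x₀ ≤ R - r / 2 := by
    have : z - x₀ = -((1 - t) • (x₀ - x)) := by rw [hz]; module
    rw [dist_eq_norm, this, norm_neg, norm_smul, Real.norm_of_nonneg (by linarith), ← htR]
    nlinarith [mul_le_mul_of_nonneg_left hx' (sub_nonneg.2 ht1)]
  have h3 : closedBall z (r / 2) ⊆ closedBall x₀ R ∩ closedBall x r :=
    subset_inter (closedBall_subset_closedBall' (by linarith))
      (closedBall_subset_closedBall' (by linarith))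
  calc volume (closedBall x r) = volume (closedBall x (2 * (r / 2))) := by congr 2; ring
    _ = ENNReal.ofReal (2 ^ d) * volume (closedBall z (r / 2)) :=
        volume_closedBall_mul x z (by norm_num) (by positivity)
    _ ≤ _ := by gcongr

/-- Reverse weak-type bound, localized to a ball. -/
lemma setLIntegral_le_mul_volume_inter {g : 𝔼 → ℝ≥0∞} (hg : Measurable g)
    (hgi : ∫⁻ x, g x ≠ ⊤) (x₀ : 𝔼) {R : ℝ} (hR : 0 < R) {a : ℝ≥0∞}
    (ha : ∫⁻ x, g x ≤ a * volume (closedBall (0 : 𝔼) R)) {T : Set 𝔼}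
    (hT : ∀ x, ∀ r : ℝ, 0 < r →
      a * volume (closedBall x r) < ∫⁻ y in closedBall x r, g y → closedBall x r ⊆ T) :
    ∫⁻ x in closedBall x₀ R ∩ {x | a < g x}, g x ≤
      ENNReal.ofReal (16 ^ d) * (a * volume (closedBall x₀ R ∩ T)) := by
  set s : Set 𝔼 := {x | x ∈ closedBall x₀ R ∩ {x | a < g x} ∧
    Tendsto (fun r => (∫⁻ y in closedBall x r, g y) / volume (closedBall x r))
      (𝓝[>] 0) (𝓝 (g x))} with hs
  have hae : ∀ᵐ x : 𝔼, Tendsto (fun r => (∫⁻ y in closedBall x r, g y) / volume (closedBall x r))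
      (𝓝[>] 0) (𝓝 (g x)) := by
    filter_upwards [(Besicovitch.vitaliFamily (volume : Measure 𝔼)).ae_tendsto_lintegral_div
      hg.aemeasurable hgi] with x hx
    exact hx.comp (Besicovitch.tendsto_filterAt volume x)
  have hsae : (closedBall x₀ R ∩ {x | a < g x} : Set 𝔼) =ᵐ[volume] s := by
    filter_upwards [hae] with x hx
    exact propext ⟨fun h => ⟨h, hx⟩, fun h => h.1⟩
  have hrad : ∀ x ∈ s, ∃ r : ℝ, 0 < r ∧ r ≤ R ∧
      a * volume (closedBall x r) < ∫⁻ y in closedBall x r, g y ∧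
      ∫⁻ y in closedBall x (8 * r), g y ≤ a * volume (closedBall x (8 * r)) := by
    rintro x ⟨⟨hxB, hxa⟩, hx⟩
    have hpos : ∀ r : ℝ, 0 < r → volume (closedBall x r) ≠ 0 := fun r hr =>
      (measure_closedBall_pos volume _ hr).ne'
    have hfin : ∀ r : ℝ, volume (closedBall x r) ≠ ⊤ := fun r => measure_closedBall_lt_top.ne
    have hseq : Tendsto (fun j : ℕ => R * (1 / 8 : ℝ) ^ j) atTop (𝓝[>] 0) := by
      refine tendsto_nhdsWithin_iff.2 ⟨?_, Eventually.of_forall fun j => ?_⟩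
      · simpa using (tendsto_pow_atTop_nhds_zero_of_lt_one (r := (1 / 8 : ℝ)) (by norm_num)
          (by norm_num)).const_mul R
      · exact mem_Ioi.2 (by positivity)
    have hex : ∃ j : ℕ, a * volume (closedBall x (R * (1 / 8 : ℝ) ^ j)) <
        ∫⁻ y in closedBall x (R * (1 / 8 : ℝ) ^ j), g y := by
      obtain ⟨j, hj⟩ := ((hx.comp hseq).eventually (lt_mem_nhds hxa)).exists
      refine ⟨j, ?_⟩
      exact (ENNReal.lt_div_iff_mul_lt (Or.inl (hpos _ (by positivity)))
        (Or.inl (hfin _))).1 hj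
    classical
    obtain ⟨k, hk⟩ : ∃ k, Nat.find hex = k + 1 := by
      refine Nat.exists_eq_succ_of_ne_zero fun h0 => ?_
      have h1 := Nat.find_spec hex
      rw [h0] at h1
      simp only [pow_zero, mul_one] at h1
      rw [Measure.addHaar_closedBall_center] at h1
      exact absurd ((setLIntegral_le_lintegral _ _).trans ha) (not_le.2 h1)
    have h1 := Nat.find_spec hex
    rw [hk] at h1
    have h2 := Nat.find_min hex (m := k) (by omega)
    refine ⟨R * (1 / 8 : ℝ) ^ (k + 1), by positivity, ?_, h1, ?_⟩
    · exact mul_le_of_le_one_right hR.le (pow_le_one₀ (by norm_num) (by norm_num))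
    · have : 8 * (R * (1 / 8 : ℝ) ^ (k + 1)) = R * (1 / 8 : ℝ) ^ k := by rw [pow_succ]; ring
      rw [this]
      exact not_lt.1 h2
  choose! r hr0 hrR hlow hup using hrad
  obtain ⟨u, hus, hcount, hdis, hcov⟩ :=
    exists_countable_disjoint_closedBall_cover s r R hr0 hrR
  have : Countable u := hcount.to_subtype
  have hcov8 : s ⊆ ⋃ x ∈ u, closedBall x (8 * r x) := by
    refine hcov.trans (iUnion₂_mono fun x hx => closedBall_subset_closedBall ?_)
    linarith [hr0 x (hus hx)]
  calc ∫⁻ x in closedBall x₀ R ∩ {x | a < g x}, g x = ∫⁻ x in s, g x :=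
        setLIntegral_congr hsae
    _ ≤ ∫⁻ x in ⋃ x ∈ u, closedBall x (8 * r x), g x := lintegral_mono_set hcov8
    _ ≤ ∑' x : u, ∫⁻ y in closedBall (x : 𝔼) (8 * r x), g y := by
        rw [biUnion_eq_iUnion]
        exact lintegral_iUnion_le _ _
    _ ≤ ∑' x : u, ENNReal.ofReal (16 ^ d) *
          (a * volume (closedBall x₀ R ∩ closedBall (x : 𝔼) (r x))) := by
        refine ENNReal.tsum_le_tsum fun x => (hup x (hus x.2)).trans ?_
        rw [volume_closedBall_mul (x : 𝔼) (x : 𝔼) (by norm_num) (hr0 x (hus x.2)).le]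
        have h16 : ENNReal.ofReal (16 ^ d) = ENNReal.ofReal (8 ^ d) * ENNReal.ofReal (2 ^ d) := by
          rw [← ENNReal.ofReal_mul (by positivity), ← mul_pow]; norm_num
        calc a * (ENNReal.ofReal (8 ^ d) * volume (closedBall (x : 𝔼) (r x)))
            ≤ a * (ENNReal.ofReal (8 ^ d) * (ENNReal.ofReal (2 ^ d) *
                volume (closedBall x₀ R ∩ closedBall (x : 𝔼) (r x)))) := by
              gcongr
              exact volume_closedBall_le_inter (hr0 x (hus x.2)) (hrR x (hus x.2))
                (hus x.2).1.1
          _ = _ := by rw [h16]; ring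
    _ = ENNReal.ofReal (16 ^ d) *
          (a * volume (⋃ x ∈ u, closedBall x₀ R ∩ closedBall (x : 𝔼) (r x))) := by
        rw [ENNReal.tsum_mul_left, ENNReal.tsum_mul_left, measure_biUnion hcount
          (hdis.mono fun x => inter_subset_right)
          (fun x _ => measurableSet_closedBall.inter measurableSet_closedBall)]
    _ ≤ _ := by
        gcongr
        refine iUnion₂_subset fun x hx => inter_subset_inter_right _ ?_
        exact hT x _ (hr0 x (hus hx)) (hlow x (hus hx))

lemma setLIntegral_ball_le_mul_maximalFn (f : 𝔼 → ℂ) (x : 𝔼) {r : ℝ} (hr : 0 < r) :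
    ∫⁻ y in ball x r, ‖f y‖ₑ ≤ volume (ball x r) * maximalFn f x := by
  have h : (volume (ball x r))⁻¹ * ∫⁻ y in ball x r, ‖f y‖ₑ ≤ maximalFn f x :=
    le_iSup₂ (f := fun (r : ℝ) (_ : 0 < r) =>
      (volume (ball x r))⁻¹ * ∫⁻ y in ball x r, ‖f y‖ₑ) r hr
  calc ∫⁻ y in ball x r, ‖f y‖ₑ
      = volume (ball x r) * ((volume (ball x r))⁻¹ * ∫⁻ y in ball x r, ‖f y‖ₑ) := by
        rw [← mul_assoc, ENNReal.mul_inv_cancel (measure_ball_pos volume _ hr).ne'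
          measure_ball_lt_top.ne, one_mul]
    _ ≤ _ := by gcongr

lemma exists_mul_volume_lt_of_lt_maximalFn {f : 𝔼 → ℂ} {x : 𝔼} {a : ℝ≥0∞}
    (h : a < maximalFn f x) :
    ∃ r : ℝ, 0 < r ∧ a * volume (ball x r) < ∫⁻ y in ball x r, ‖f y‖ₑ := by
  obtain ⟨r, hr, h⟩ : ∃ r : ℝ, ∃ _ : 0 < r,
      a < (volume (ball x r))⁻¹ * ∫⁻ y in ball x r, ‖f y‖ₑ := by
    simpa only [maximalFn, lt_iSup_iff, ← enorm_eq_nnnorm] using h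
  refine ⟨r, hr, ?_⟩
  rw [mul_comm, ← div_eq_mul_inv] at h
  exact (ENNReal.lt_div_iff_mul_lt (Or.inl (measure_ball_pos volume _ hr).ne')
    (Or.inl measure_ball_lt_top.ne)).1 h

lemma lowerSemicontinuous_maximalFn (f : 𝔼 → ℂ) : LowerSemicontinuous (maximalFn f) := by
  intro x a ha
  obtain ⟨r, hr, h⟩ := exists_mul_volume_lt_of_lt_maximalFn ha
  have hmono : Monotone fun n : ℕ => ball x (r - 1 / ((n : ℝ) + 1)) := fun m n hmn =>
    ball_subset_ball (sub_le_sub_left (Nat.one_div_le_one_div hmn) r)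
  have hunion : ⋃ n : ℕ, ball x (r - 1 / ((n : ℝ) + 1)) = ball x r := by
    refine Subset.antisymm (iUnion_subset fun n => ball_subset_ball ?_) fun y hy => ?_
    · have : (0 : ℝ) < 1 / ((n : ℝ) + 1) := Nat.one_div_pos_of_nat
      linarith
    · obtain ⟨n, hn⟩ := exists_nat_one_div_lt (sub_pos.2 (mem_ball.1 hy))
      exact mem_iUnion.2 ⟨n, mem_ball.2 (by linarith)⟩
  have hlim := tendsto_measure_iUnion_atTop (μ := volume.withDensity fun y => ‖f y‖ₑ) hmono
  rw [hunion, withDensity_apply _ measurableSet_ball] at hlim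
  obtain ⟨n, hn⟩ := (hlim.eventually (lt_mem_nhds h)).exists
  simp only [Function.comp_apply] at hn
  rw [withDensity_apply _ measurableSet_ball] at hn
  filter_upwards [ball_mem_nhds x (Nat.one_div_pos_of_nat (α := ℝ) (n := n))] with y hy
  have hsub : ball x (r - 1 / ((n : ℝ) + 1)) ⊆ ball y r := by
    refine ball_subset_ball' ?_
    rw [mem_ball, dist_comm] at hy
    linarith
  have h1 : a * volume (ball y r) < volume (ball y r) * maximalFn f y := by
    calc a * volume (ball y r) = a * volume (ball x r) := by
          rw [Measure.addHaar_ball_center volume y, Measure.addHaar_ball_center volume x]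
      _ < _ := hn
      _ ≤ ∫⁻ y in ball y r, ‖f y‖ₑ := lintegral_mono_set hsub
      _ ≤ _ := setLIntegral_ball_le_mul_maximalFn f y hr
  rw [mul_comm] at h1
  exact lt_of_mul_lt_mul_left' h1

lemma measurable_maximalFn (f : 𝔼 → ℂ) : Measurable (maximalFn f) :=
  (lowerSemicontinuous_maximalFn f).measurable

/-- The weak type `(1, 1)` inequality, in its localized form. -/
lemma mul_volume_lt_maximalFn_le (hd : 1 ≤ d) {f : 𝔼 → ℂ} (hf : Measurable f)
    (hfi : ∫⁻ x, ‖f x‖ₑ ≠ ⊤) {a : ℝ≥0∞} (ha : a ≠ 0) :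
    a * volume {x | a < maximalFn f x} ≤
      ENNReal.ofReal (2 * 5 ^ d) * ∫⁻ x in {x | a < 2 * ‖f x‖ₑ}, ‖f x‖ₑ := by
  have : Nontrivial 𝔼 := by
    have : Nonempty (Fin d) := ⟨⟨0, hd⟩⟩
    infer_instance
  set S : Set 𝔼 := {x | a < 2 * ‖f x‖ₑ}
  have hSm : MeasurableSet S := measurableSet_lt measurable_const (hf.enorm.const_mul 2)
  have ha2 : a / 2 + a / 2 = a := ENNReal.add_halves a
  have key : a / 2 * volume {x | a < maximalFn f x} ≤
      ENNReal.ofReal (5 ^ d) * ∫⁻ x, S.indicator (fun x => ‖f x‖ₑ) x := by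
    refine mul_volume_le_of_forall_exists_closedBall hd ?_ (by simpa using ha) fun x hx => ?_
    · exact ((lintegral_mono (indicator_le_self _ _)).trans_lt hfi.lt_top).ne
    obtain ⟨r, hr, h⟩ := exists_mul_volume_lt_of_lt_maximalFn hx
    refine ⟨r, hr, ?_⟩
    rw [Measure.addHaar_closedBall_eq_addHaar_ball]
    have h1 : ∫⁻ y in ball x r, ‖f y‖ₑ ≤
        (∫⁻ y in ball x r, S.indicator (fun x => ‖f x‖ₑ) y) + a / 2 * volume (ball x r) := by
      rw [← setLIntegral_const, ← lintegral_add_right _ measurable_const]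
      refine lintegral_mono fun y => ?_
      by_cases hy : y ∈ S
      · simp [hy]
      · rw [indicator_of_notMem hy, zero_add,
          ENNReal.le_div_iff_mul_le (Or.inl two_ne_zero) (Or.inl ofNat_ne_top), mul_comm]
        exact not_lt.1 hy
    have h2 : a / 2 * volume (ball x r) + a / 2 * volume (ball x r) <
        (∫⁻ y in ball x r, S.indicator (fun x => ‖f x‖ₑ) y) + a / 2 * volume (ball x r) := by
      rw [← add_mul, ha2]
      exact h.trans_le h1
    refine (lt_of_add_lt_add_right h2).le.trans (lintegral_mono_set ball_subset_closedBall)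
  rw [lintegral_indicator hSm] at key
  calc a * volume {x | a < maximalFn f x} = 2 * (a / 2 * volume {x | a < maximalFn f x}) := by
        rw [← mul_assoc, ENNReal.mul_div_cancel two_ne_zero ofNat_ne_top]
    _ ≤ 2 * (ENNReal.ofReal (5 ^ d) * ∫⁻ x in S, ‖f x‖ₑ) := by gcongr
    _ = _ := by rw [← mul_assoc, ENNReal.ofReal_mul (by norm_num), ENNReal.ofReal_ofNat]

lemma closedBall_subset_lt_maximalFn (hd : 1 ≤ d) (f : 𝔼 → ℂ) {x : 𝔼} {r : ℝ} (hr : 0 < r)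
    {a : ℝ≥0∞} (h : a * volume (closedBall x r) < ∫⁻ y in closedBall x r, ‖f y‖ₑ) :
    closedBall x r ⊆ {y | a < ENNReal.ofReal (3 ^ d) * maximalFn f y} := by
  have : Nontrivial 𝔼 := by
    have : Nonempty (Fin d) := ⟨⟨0, hd⟩⟩
    infer_instance
  intro y hy
  have hsub : closedBall x r ⊆ ball y (3 * r) := by
    intro z hz
    rw [mem_closedBall] at hz hy
    rw [mem_ball]
    linarith [dist_triangle_right z y x]
  have h1 : volume (closedBall x r) * a <
      volume (closedBall x r) * (ENNReal.ofReal (3 ^ d) * maximalFn f y) := by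
    calc volume (closedBall x r) * a = a * volume (closedBall x r) := mul_comm _ _
      _ < _ := h
      _ ≤ ∫⁻ y in ball y (3 * r), ‖f y‖ₑ := lintegral_mono_set hsub
      _ ≤ _ := setLIntegral_ball_le_mul_maximalFn f y (by positivity)
      _ = _ := by
        rw [← Measure.addHaar_closedBall_eq_addHaar_ball,
          volume_closedBall_mul y x (by norm_num) hr.le]
        ring
  exact lt_of_mul_lt_mul_left' h1

lemma maximalFn_eq_top {f : 𝔼 → ℂ} {x₀ : 𝔼} {R : ℝ} (hR : 0 ≤ R)
    (hsupp : Function.support f ⊆ closedBall x₀ R) (hfi : ∫⁻ x, ‖f x‖ₑ = ⊤) (x : 𝔼) :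
    maximalFn f x = ⊤ := by
  have hr : 0 < dist x x₀ + R + 1 := by positivity
  have h := setLIntegral_ball_le_mul_maximalFn f x hr
  rw [setLIntegral_eq_of_support_subset (μ := volume), hfi, top_le_iff,
    ENNReal.mul_eq_top] at h
  · rcases h with h | h
    · exact h.2
    · exact absurd h.1 measure_ball_lt_top.ne
  · intro y hy
    have hy' : dist y x₀ ≤ R := hsupp fun h0 => hy (by simp [h0])
    rw [mem_ball]
    linarith [dist_triangle_right y x x₀]

/-- Fubini for superlevel sets. -/
lemma lintegral_mul_setLIntegral_superlevel {X : Type*} [MeasurableSpace X] (μ : Measure X)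
    [SFinite μ] {F h : X → ℝ≥0∞} (hF : Measurable F) (hh : Measurable h) {k : ℝ → ℝ≥0∞}
    (hk : Measurable k) (L : ℝ) :
    ∫⁻ x, (h x * ∫⁻ t in Ioi L ∩ {t | ENNReal.ofReal t < F x}, k t) ∂μ =
      ∫⁻ t in Ioi L, k t * ∫⁻ x in {x | ENNReal.ofReal t < F x}, h x ∂μ := by
  have hS : MeasurableSet {p : X × ℝ | ENNReal.ofReal p.2 < F p.1} :=
    measurableSet_lt (ENNReal.measurable_ofReal.comp measurable_snd) (hF.comp measurable_fst)
  have hS1 : ∀ x, MeasurableSet {t : ℝ | ENNReal.ofReal t < F x} := fun x =>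
    measurableSet_lt ENNReal.measurable_ofReal measurable_const
  have hS2 : ∀ t : ℝ, MeasurableSet {x | ENNReal.ofReal t < F x} := fun t =>
    measurableSet_lt measurable_const hF
  set G : X × ℝ → ℝ≥0∞ :=
    {p : X × ℝ | ENNReal.ofReal p.2 < F p.1}.indicator fun p => h p.1 * k p.2 with hG
  have hGm : Measurable G :=
    ((hh.comp measurable_fst).mul (hk.comp measurable_snd)).indicator hS
  calc ∫⁻ x, (h x * ∫⁻ t in Ioi L ∩ {t | ENNReal.ofReal t < F x}, k t) ∂μ
      = ∫⁻ x, (∫⁻ t in Ioi L, G (x, t)) ∂μ := by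
        refine lintegral_congr fun x => ?_
        rw [inter_comm, ← Measure.restrict_restrict (hS1 x), ← lintegral_const_mul _ hk,
          ← lintegral_indicator (hS1 x)]
        rfl
    _ = ∫⁻ t in Ioi L, ∫⁻ x, G (x, t) ∂μ := lintegral_lintegral_swap hGm.aemeasurable
    _ = _ := by
        refine lintegral_congr fun t => ?_
        rw [← lintegral_const_mul _ hh, ← lintegral_indicator (hS2 t)]
        refine lintegral_congr fun x => ?_
        simp only [hG, indicator_apply, mem_ofPred_eq, mul_comm (h x)]

lemma Ioi_inter_ofReal_lt {L : ℝ} (hL : 0 ≤ L) (s : ℝ) :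
    Ioi L ∩ {t : ℝ | ENNReal.ofReal t < ENNReal.ofReal s} = Ioo L s := by
  ext t
  simp only [mem_inter_iff, mem_Ioi, mem_ofPred_eq, mem_Ioo]
  refine and_congr_right fun ht => ?_
  exact ENNReal.ofReal_lt_ofReal_iff_of_nonneg (hL.trans ht.le)

/-- The fundamental theorem of calculus for lower integrals. -/
lemma setLIntegral_Ioo_ofReal_deriv {φ φ' : ℝ → ℝ} {a b : ℝ} (hab : a ≤ b)
    (hφ : ∀ t ∈ Icc a b, HasDerivAt φ (φ' t) t) (hc : ContinuousOn φ' (Icc a b))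
    (hpos : ∀ t ∈ Icc a b, 0 ≤ φ' t) :
    ∫⁻ t in Ioo a b, ENNReal.ofReal (φ' t) = ENNReal.ofReal (φ b - φ a) := by
  have hint : IntervalIntegrable φ' volume a b := by
    refine ContinuousOn.intervalIntegrable ?_
    rwa [uIcc_of_le hab]
  rw [← intervalIntegral.integral_eq_sub_of_hasDerivAt (by rwa [uIcc_of_le hab]) hint,
    intervalIntegral.integral_of_le hab, ofReal_integral_eq_lintegral_ofReal hint.1,
    Measure.restrict_congr_set Ioo_ae_eq_Ioc]
  filter_upwards [ae_restrict_mem measurableSet_Ioc] with t ht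
  exact hpos t (Ioc_subset_Icc_self ht)

lemma setLIntegral_inv_log_le {L s : ℝ} (hL : Real.exp 2 ≤ L) (hs : L ≤ s) :
    ∫⁻ t in Ioo L s, ENNReal.ofReal (1 / Real.log t) ≤
      ENNReal.ofReal (2 * s / Real.log s) := by
  have hL0 : 0 < L := (Real.exp_pos 2).trans_le hL
  have hlog : ∀ t ∈ Icc L s, 2 ≤ Real.log t := fun t ht => by
    rw [Real.le_log_iff_exp_le (hL0.trans_le ht.1)]
    exact hL.trans ht.1
  have hne : ∀ t ∈ Icc L s, Real.log t ≠ 0 := fun t ht => by linarith [hlog t ht]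
  have ht0 : ∀ t ∈ Icc L s, t ≠ 0 := fun t ht => (hL0.trans_le ht.1).ne'
  have hle : ∀ t ∈ Icc L s, 1 / Real.log t ≤
      (2 * Real.log t - 2 * t * t⁻¹) / Real.log t ^ 2 := fun t ht => by
    have h2 := hlog t ht
    rw [mul_assoc, mul_inv_cancel₀ (ht0 t ht), div_le_div_iff₀ (by linarith) (by positivity)]
    nlinarith
  calc ∫⁻ t in Ioo L s, ENNReal.ofReal (1 / Real.log t)
      ≤ ∫⁻ t in Ioo L s, ENNReal.ofReal ((2 * Real.log t - 2 * t * t⁻¹) / Real.log t ^ 2) := by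
        refine setLIntegral_mono' measurableSet_Ioo fun t ht => ?_
        exact ENNReal.ofReal_le_ofReal (hle t (Ioo_subset_Icc_self ht))
    _ = ENNReal.ofReal (2 * s / Real.log s - 2 * L / Real.log L) := by
        refine setLIntegral_Ioo_ofReal_deriv (φ := fun t => 2 * t / Real.log t) hs
          (fun t ht => ?_) ?_ fun t ht => ?_
        · have h1 : HasDerivAt (fun t : ℝ => 2 * t) 2 t := by
            simpa using (hasDerivAt_id t).const_mul (2 : ℝ)
          exact h1.div (Real.hasDerivAt_log (ht0 t ht)) (hne t ht)
        · have h1 : ContinuousOn Real.log (Icc L s) := Real.continuousOn_log.mono ht0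
          have h2 : ContinuousOn (fun t : ℝ => t⁻¹) (Icc L s) := continuousOn_inv₀.mono ht0
          exact ((continuousOn_const.mul h1).sub
            ((continuousOn_const.mul continuousOn_id).mul h2)).div (h1.pow 2)
            fun t ht => pow_ne_zero 2 (hne t ht)
        · exact le_trans (by have := hlog t ht; positivity) (hle t ht)
    _ ≤ _ := by
        refine ENNReal.ofReal_le_ofReal ?_
        have := hlog L ⟨le_rfl, hs⟩
        have : 0 ≤ 2 * L / Real.log L := by positivity
        linarith

lemma setLIntegral_inv_mul_log {L s : ℝ} (hL : Real.exp 1 ≤ L) (hs : L ≤ s) :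
    ∫⁻ t in Ioo L s, ENNReal.ofReal (1 / (t * Real.log t)) =
      ENNReal.ofReal (Real.log (Real.log s) - Real.log (Real.log L)) := by
  have hL0 : 0 < L := (Real.exp_pos 1).trans_le hL
  have ht0 : ∀ t ∈ Icc L s, 0 < t := fun t ht => hL0.trans_le ht.1
  have hlog : ∀ t ∈ Icc L s, 0 < Real.log t := fun t ht => by
    have : 1 ≤ Real.log t := by
      rw [Real.le_log_iff_exp_le (ht0 t ht)]
      exact hL.trans ht.1
    linarith
  refine setLIntegral_Ioo_ofReal_deriv (φ := fun t => Real.log (Real.log t)) hs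
    (fun t ht => ?_) ?_ fun t ht => ?_
  · convert (Real.hasDerivAt_log (ht0 t ht).ne').log (hlog t ht).ne' using 1
    field_simp
  · have h1 : ContinuousOn Real.log (Icc L s) :=
      Real.continuousOn_log.mono fun t ht => (ht0 t ht).ne'
    exact continuousOn_const.div (continuousOn_id.mul h1)
      fun t ht => mul_ne_zero (ht0 t ht).ne' (hlog t ht).ne'
  · have := ht0 t ht
    have := hlog t ht
    positivity

lemma setLIntegral_Ioi_inv_log : 
    ∫⁻ t in Ioi (Real.exp 1), ENNReal.ofReal (1 / Real.log t) = ⊤ := by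
  refine ENNReal.eq_top_of_forall_nnreal_le fun r => ?_
  have he : Real.exp 1 ≤ Real.exp (r + 1) := Real.exp_le_exp.2 (by simp)
  have hpos : ∀ t : ℝ, Real.exp 1 ≤ t → 0 < t := fun t ht => (Real.exp_pos 1).trans_le ht
  calc (r : ℝ≥0∞) = ENNReal.ofReal (Real.log (Real.exp (r + 1)) - Real.log (Real.exp 1)) := by
        simp
    _ = ∫⁻ t in Ioo (Real.exp 1) (Real.exp (r + 1)), ENNReal.ofReal t⁻¹ := by
        refine (setLIntegral_Ioo_ofReal_deriv he
          (fun t ht => Real.hasDerivAt_log (hpos t ht.1).ne')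
          (continuousOn_inv₀.mono fun t ht => (hpos t ht.1).ne') fun t ht => ?_).symm
        exact inv_nonneg.2 (hpos t ht.1).le
    _ ≤ ∫⁻ t in Ioo (Real.exp 1) (Real.exp (r + 1)), ENNReal.ofReal (1 / Real.log t) := by
        refine setLIntegral_mono' measurableSet_Ioo fun t ht => ENNReal.ofReal_le_ofReal ?_
        have h1 : 1 ≤ Real.log t := (Real.le_log_iff_exp_le (hpos t ht.1.le)).2 ht.1.le
        rw [one_div]
        exact inv_anti₀ (by linarith) (Real.log_le_self (hpos t ht.1.le).le)
    _ ≤ _ := lintegral_mono_set fun t ht => ht.1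

lemma log_exp_one_add_ge {s : ℝ} (hs : 0 ≤ s) : 1 ≤ Real.log (Real.exp 1 + s) := by
  rw [Real.le_log_iff_exp_le (by positivity)]
  linarith

lemma ofReal_div_log_le {s : ℝ} (hs : 0 ≤ s) :
    ENNReal.ofReal (s / Real.log (Real.exp 1 + s)) ≤ ENNReal.ofReal (Real.exp 1) +
      ∫⁻ t in Ioo (Real.exp 1) s, ENNReal.ofReal (1 / Real.log t) := by
  have he := Real.exp_pos 1
  have hlog1 := log_exp_one_add_ge hs
  rcases le_or_gt s (Real.exp 1) with h1 | h1
  · refine le_add_right (ENNReal.ofReal_le_ofReal ?_)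
    exact (div_le_self hs hlog1).trans h1
  have h0 : 0 < s := he.trans h1
  have hlog2 : 1 ≤ Real.log s := (Real.le_log_iff_exp_le h0).2 h1.le
  have hmono : Real.log s ≤ Real.log (Real.exp 1 + s) := Real.log_le_log h0 (by linarith)
  calc ENNReal.ofReal (s / Real.log (Real.exp 1 + s))
      ≤ ENNReal.ofReal (Real.exp 1 + (s - Real.exp 1) / Real.log s) := by
        refine ENNReal.ofReal_le_ofReal ?_
        calc s / Real.log (Real.exp 1 + s) ≤ s / Real.log s := by gcongr
          _ = Real.exp 1 / Real.log s + (s - Real.exp 1) / Real.log s := by ring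
          _ ≤ _ := by gcongr; exact div_le_self he.le hlog2
    _ ≤ ENNReal.ofReal (Real.exp 1) + ENNReal.ofReal ((s - Real.exp 1) / Real.log s) :=
        ENNReal.ofReal_add_le
    _ = ENNReal.ofReal (Real.exp 1) +
          ∫⁻ t in Ioo (Real.exp 1) s, ENNReal.ofReal (1 / Real.log s) := by
        rw [setLIntegral_const, Real.volume_Ioo, ← ENNReal.ofReal_mul (by positivity)]
        congr 2
        ring
    _ ≤ _ := by
        gcongr _ + ?_
        refine setLIntegral_mono' measurableSet_Ioo fun t ht => ENNReal.ofReal_le_ofReal ?_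
        have : 0 < Real.log t := Real.log_pos (by linarith [ht.1, Real.add_one_le_exp 1])
        exact one_div_le_one_div_of_le this
          (Real.log_le_log (he.trans ht.1) ht.2.le)

lemma PsiE_top (x : 𝔼) : PsiE x ⊤ = ⊤ := ENNReal.top_div_of_ne_top ENNReal.ofReal_ne_top

lemma PsiE_ofReal (x : 𝔼) {s : ℝ} (hs : 0 ≤ s) :
    PsiE x (ENNReal.ofReal s) =
      ENNReal.ofReal (s / (Real.log (Real.exp 1 + s) + Real.log (Real.exp 1 + ‖x‖))) := by
  have h1 := log_exp_one_add_ge hs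
  have h2 := log_exp_one_add_ge (norm_nonneg x)
  rw [PsiE, ENNReal.toReal_ofReal hs, ENNReal.ofReal_div_of_pos (by linarith)]

lemma PsiE_le (x : 𝔼) (t : ℝ≥0∞) :
    PsiE x t ≤ ENNReal.ofReal (Real.exp 1) +
      ∫⁻ l in Ioi (Real.exp 1) ∩ {l | ENNReal.ofReal l < t},
        ENNReal.ofReal (1 / Real.log l) := by
  rcases eq_or_ne t ⊤ with rfl | ht
  · have : {l : ℝ | ENNReal.ofReal l < ⊤} = univ := by ext; simp
    rw [this, inter_univ, setLIntegral_Ioi_inv_log, add_top]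
    exact le_top
  rw [← ENNReal.ofReal_toReal ht]
  set s := t.toReal
  have hs : 0 ≤ s := ENNReal.toReal_nonneg
  rw [PsiE_ofReal x hs, Ioi_inter_ofReal_lt (Real.exp_pos 1).le]
  refine le_trans (ENNReal.ofReal_le_ofReal ?_) (ofReal_div_log_le hs)
  have h1 := log_exp_one_add_ge hs
  have h2 := log_exp_one_add_ge (norm_nonneg x)
  gcongr
  linarith

lemma le_PsiE {ρ C L : ℝ} (hC : 1 ≤ C) (hL : Real.exp 2 ≤ L) {x : 𝔼} (hx : ‖x‖ ≤ ρ)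
    (t : ℝ≥0∞) :
    ∫⁻ l in Ioi L ∩ {l | ENNReal.ofReal l < ENNReal.ofReal C * t},
        ENNReal.ofReal (1 / Real.log l) ≤
      ENNReal.ofReal (2 * C * (2 + Real.log (Real.exp 1 + ρ))) * PsiE x t := by
  have hρ : 0 ≤ ρ := (norm_nonneg x).trans hx
  have hD := log_exp_one_add_ge hρ
  set D := Real.log (Real.exp 1 + ρ)
  rcases eq_or_ne t ⊤ with rfl | ht
  · have hK : ENNReal.ofReal (2 * C * (2 + D)) ≠ 0 :=
      (ENNReal.ofReal_pos.2 (by positivity)).ne'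
    rw [PsiE_top, ENNReal.mul_top hK]
    exact le_top
  rw [← ENNReal.ofReal_toReal ht]
  set s := t.toReal
  have hs : 0 ≤ s := ENNReal.toReal_nonneg
  have he2 : (3 : ℝ) ≤ Real.exp 2 := by linarith [Real.add_one_le_exp (2 : ℝ)]
  rw [← ENNReal.ofReal_mul (by linarith), Ioi_inter_ofReal_lt (by linarith)]
  rcases le_or_gt (C * s) L with h | h
  · simp [Ioo_eq_empty_of_le h]
  refine (setLIntegral_inv_log_le hL h.le).trans ?_
  rw [PsiE_ofReal x hs, ← ENNReal.ofReal_mul (by positivity)]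
  refine ENNReal.ofReal_le_ofReal ?_
  have hu0 : 0 < C * s := by linarith
  have hu : 2 ≤ Real.log (C * s) := by
    rw [Real.le_log_iff_exp_le hu0]; linarith
  have h1 : Real.log (Real.exp 1 + s) ≤ 2 * Real.log (C * s) := by
    have : 2 * Real.log (C * s) = Real.log ((C * s) ^ 2) := by
      rw [Real.log_pow]; norm_num
    rw [this]
    refine Real.log_le_log (by positivity) ?_
    have h3 : s ≤ C * s := le_mul_of_one_le_left hs hC
    have h4 : Real.exp 1 ≤ Real.exp 2 := Real.exp_le_exp.2 (by norm_num)
    nlinarith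
  have h2 : Real.log (Real.exp 1 + ‖x‖) ≤ D := Real.log_le_log (by positivity) (by linarith)
  have h3 : D ≤ D * Real.log (C * s) := le_mul_of_one_le_right (by linarith) (by linarith)
  have h4 := log_exp_one_add_ge hs
  have h5 := log_exp_one_add_ge (norm_nonneg x)
  rw [← mul_div_assoc, div_le_div_iff₀ (by linarith) (by linarith)]
  have h6 : Real.log (Real.exp 1 + s) + Real.log (Real.exp 1 + ‖x‖) ≤
      (2 + D) * Real.log (C * s) := by linarith
  calc 2 * (C * s) * (Real.log (Real.exp 1 + s) + Real.log (Real.exp 1 + ‖x‖))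
      ≤ 2 * (C * s) * ((2 + D) * Real.log (C * s)) := by gcongr
    _ = _ := by ring

lemma logPlus_nonneg (s : ℝ) : 0 ≤ logPlus s := le_max_right _ _

lemma logPlus_mono {s t : ℝ} (hs : 0 ≤ s) (hst : s ≤ t) : logPlus s ≤ logPlus t := by
  rcases hs.eq_or_lt with rfl | h
  · simp [logPlus]
  · exact max_le_max_right 0 (Real.log_le_log h hst)

lemma measurable_logPlus : Measurable logPlus := Real.measurable_log.max measurable_const

lemma logPlus_logPlus_of_exp_one_le {s : ℝ} (hs : Real.exp 1 ≤ s) :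
    logPlus (logPlus s) = Real.log (Real.log s) := by
  have h1 : 1 ≤ Real.log s := (Real.le_log_iff_exp_le ((Real.exp_pos 1).trans_le hs)).2 hs
  rw [logPlus, logPlus, max_eq_left (by linarith : 0 ≤ Real.log s),
    max_eq_left (Real.log_nonneg h1)]

lemma ofReal_logPlus_logPlus_le {L s : ℝ} (hL : Real.exp 1 ≤ L) (hs : 0 ≤ s) :
    ENNReal.ofReal (logPlus (logPlus s)) ≤ ENNReal.ofReal (Real.log (Real.log L)) +
      ∫⁻ l in Ioi L ∩ {l | ENNReal.ofReal l < ENNReal.ofReal s},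
        ENNReal.ofReal (1 / (l * Real.log l)) := by
  rcases le_or_gt s L with h | h
  · refine le_add_right (ENNReal.ofReal_le_ofReal ?_)
    rw [← logPlus_logPlus_of_exp_one_le hL]
    exact logPlus_mono (logPlus_nonneg s) (logPlus_mono hs h)
  · rw [Ioi_inter_ofReal_lt ((Real.exp_pos 1).le.trans hL), setLIntegral_inv_mul_log hL h.le,
      logPlus_logPlus_of_exp_one_le (hL.trans h.le)]
    refine le_trans (ENNReal.ofReal_le_ofReal ?_) ENNReal.ofReal_add_le
    linarith

lemma setLIntegral_inv_mul_log_le (s : ℝ) :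
    ∫⁻ l in Ioi (Real.exp 1) ∩ {l | ENNReal.ofReal l < 2 * ENNReal.ofReal s},
        ENNReal.ofReal (1 / (l * Real.log l)) ≤
      ENNReal.ofReal (logPlus (logPlus s) + Real.log 2) := by
  have h2 : (2 : ℝ≥0∞) * ENNReal.ofReal s = ENNReal.ofReal (2 * s) := by
    rw [ENNReal.ofReal_mul (by norm_num), ENNReal.ofReal_ofNat]
  rw [h2, Ioi_inter_ofReal_lt (Real.exp_pos 1).le]
  rcases le_or_gt (2 * s) (Real.exp 1) with h | h
  · simp [Ioo_eq_empty_of_le h]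
  have hs0 : 0 < s := by linarith [Real.exp_pos 1]
  rw [setLIntegral_inv_mul_log le_rfl h.le]
  refine ENNReal.ofReal_le_ofReal ?_
  have hlog : 1 ≤ Real.log (2 * s) := (Real.le_log_iff_exp_le (by positivity)).2 h.le
  have hl2 : Real.log 2 ≤ 1 := by linarith [Real.log_two_lt_d9]
  have hl : Real.log (2 * s) = Real.log 2 + Real.log s :=
    Real.log_mul (by norm_num) hs0.ne'
  rw [Real.log_exp, Real.log_one, sub_zero]
  rcases le_or_gt (Real.log s) 1 with h1 | h1
  · have : Real.log (Real.log (2 * s)) ≤ Real.log 2 :=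
      Real.log_le_log (by linarith) (by linarith)
    linarith [logPlus_nonneg (logPlus s)]
  · have h3 : Real.exp 1 ≤ s := (Real.le_log_iff_exp_le hs0).1 h1.le
    rw [logPlus_logPlus_of_exp_one_le h3, add_comm, ← Real.log_mul (by norm_num) (by linarith)]
    exact Real.log_le_log (by linarith) (by linarith)

lemma lintegral_enorm_ne_top_of_logPlus {f : 𝔼 → ℂ} {s : Set 𝔼} (hs : volume s ≠ ⊤)
    (h : ∫⁻ x in s, ENNReal.ofReal (‖f x‖ * logPlus (logPlus ‖f x‖)) ≠ ⊤) :
    ∫⁻ x in s, ‖f x‖ₑ ≠ ⊤ := by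
  set K := Real.exp (Real.exp 1) with hK
  have hle : ∀ x, ‖f x‖ₑ ≤ ENNReal.ofReal K +
      ENNReal.ofReal (‖f x‖ * logPlus (logPlus ‖f x‖)) := by
    intro x
    rw [← ofReal_norm]
    rcases le_or_gt ‖f x‖ K with hx | hx
    · exact le_add_right (ENNReal.ofReal_le_ofReal hx)
    · refine le_add_left (ENNReal.ofReal_le_ofReal (le_mul_of_one_le_right (norm_nonneg _) ?_))
      have h1 : logPlus (logPlus K) = 1 := by
        rw [logPlus_logPlus_of_exp_one_le, hK, Real.log_exp, Real.log_exp]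
        exact Real.exp_le_exp.2 (by linarith [Real.add_one_le_exp (1 : ℝ)])
      rw [← h1]
      exact logPlus_mono (logPlus_nonneg _) (logPlus_mono (Real.exp_pos _).le hx.le)
  have h1 : ∫⁻ x in s, ‖f x‖ₑ ≤ ENNReal.ofReal K * volume s +
      ∫⁻ x in s, ENNReal.ofReal (‖f x‖ * logPlus (logPlus ‖f x‖)) := by
    rw [← setLIntegral_const, ← lintegral_add_left measurable_const]
    exact lintegral_mono hle
  exact (h1.trans_lt (ENNReal.add_lt_top.2
    ⟨ENNReal.mul_lt_top ENNReal.ofReal_lt_top hs.lt_top, h.lt_top⟩)).ne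

/-- The maximal function of an `L log log L` function is locally in `L_Ψ`. -/
lemma setLIntegral_PsiE_maximalFn_lt_top (hd : 1 ≤ d) {f : 𝔼 → ℂ} (hf : Measurable f)
    {s : Set 𝔼} (hs : volume s ≠ ⊤) (hsupp : Function.support f ⊆ s)
    (h : ∫⁻ x in s, ENNReal.ofReal (‖f x‖ * logPlus (logPlus ‖f x‖)) < ⊤) :
    ∫⁻ x in s, PsiE x (maximalFn f x) < ⊤ := by
  have hk : Measurable fun l : ℝ => ENNReal.ofReal (1 / Real.log l) :=
    (measurable_const.div Real.measurable_log).ennreal_ofReal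
  have hk' : Measurable fun l : ℝ => ENNReal.ofReal (1 / (l * Real.log l)) :=
    (measurable_const.div (measurable_id.mul Real.measurable_log)).ennreal_ofReal
  have hfs := lintegral_enorm_ne_top_of_logPlus hs h.ne
  have hes : (Function.support fun x => ‖f x‖ₑ) ⊆ s := fun x hx =>
    hsupp fun h0 => hx (by simp [h0])
  have hfi : ∫⁻ x, ‖f x‖ₑ ≠ ⊤ := by
    rwa [← setLIntegral_eq_of_support_subset hes]
  have hM : Measurable (maximalFn f) := measurable_maximalFn f
  set A : ℝ≥0∞ := ENNReal.ofReal (2 * 5 ^ d)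
  have hmain : ∫⁻ x in s, (∫⁻ l in Ioi (Real.exp 1) ∩ {l | ENNReal.ofReal l < maximalFn f x},
      ENNReal.ofReal (1 / Real.log l)) < ⊤ := by
    calc ∫⁻ x in s, (∫⁻ l in Ioi (Real.exp 1) ∩ {l | ENNReal.ofReal l < maximalFn f x},
          ENNReal.ofReal (1 / Real.log l))
        ≤ ∫⁻ x, 1 * (∫⁻ l in Ioi (Real.exp 1) ∩ {l | ENNReal.ofReal l < maximalFn f x},
          ENNReal.ofReal (1 / Real.log l)) := by
          simp only [one_mul]
          exact setLIntegral_le_lintegral _ _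
      _ = ∫⁻ l in Ioi (Real.exp 1), ENNReal.ofReal (1 / Real.log l) *
            ∫⁻ x in {x | ENNReal.ofReal l < maximalFn f x}, 1 :=
          lintegral_mul_setLIntegral_superlevel volume hM measurable_const hk _
      _ ≤ ∫⁻ l in Ioi (Real.exp 1), A * (ENNReal.ofReal (1 / (l * Real.log l)) *
            ∫⁻ x in {x | ENNReal.ofReal l < 2 * ‖f x‖ₑ}, ‖f x‖ₑ) := by
          refine setLIntegral_mono' measurableSet_Ioi fun l hl => ?_
          have hl0 : 0 < l := (Real.exp_pos 1).trans hl
          have hweak := mul_volume_lt_maximalFn_le hd hf hfi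
            (a := ENNReal.ofReal l) (ENNReal.ofReal_pos.2 hl0).ne'
          have hfac : ENNReal.ofReal (1 / Real.log l) =
              ENNReal.ofReal (1 / (l * Real.log l)) * ENNReal.ofReal l := by
            rw [← ENNReal.ofReal_mul' hl0.le]
            congr 1
            field_simp
          rw [setLIntegral_one, hfac, mul_assoc, mul_left_comm A]
          gcongr
      _ = A * ∫⁻ x, (‖f x‖ₑ * ∫⁻ l in Ioi (Real.exp 1) ∩
            {l | ENNReal.ofReal l < 2 * ‖f x‖ₑ}, ENNReal.ofReal (1 / (l * Real.log l))) := by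
          rw [lintegral_const_mul' _ _ ENNReal.ofReal_ne_top,
            lintegral_mul_setLIntegral_superlevel volume (hf.enorm.const_mul 2) hf.enorm hk']
      _ ≤ A * ∫⁻ x, ‖f x‖ₑ * ENNReal.ofReal (logPlus (logPlus ‖f x‖) + Real.log 2) := by
          gcongr with x
          have := setLIntegral_inv_mul_log_le ‖f x‖
          rwa [ofReal_norm] at this
      _ = A * ∫⁻ x in s, ‖f x‖ₑ * ENNReal.ofReal (logPlus (logPlus ‖f x‖) + Real.log 2) := by
          rw [setLIntegral_eq_of_support_subset]
          exact fun x hx => hes (left_ne_zero_of_mul hx)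
      _ = A * ((∫⁻ x in s, ENNReal.ofReal (‖f x‖ * logPlus (logPlus ‖f x‖))) +
            (∫⁻ x in s, ‖f x‖ₑ) * ENNReal.ofReal (Real.log 2)) := by
          rw [← lintegral_mul_const _ hf.enorm,
            ← lintegral_add_right _ (hf.enorm.mul_const _)]
          congr 2
          funext x
          rw [ENNReal.ofReal_add (logPlus_nonneg _) (Real.log_nonneg (by norm_num)), mul_add,
            ENNReal.ofReal_mul (norm_nonneg _), ofReal_norm]
      _ < ⊤ := ENNReal.mul_lt_top ENNReal.ofReal_lt_top (ENNReal.add_lt_top.2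
          ⟨h, ENNReal.mul_lt_top hfs.lt_top ENNReal.ofReal_lt_top⟩)
  calc ∫⁻ x in s, PsiE x (maximalFn f x)
      ≤ ∫⁻ x in s, (ENNReal.ofReal (Real.exp 1) +
          ∫⁻ l in Ioi (Real.exp 1) ∩ {l | ENNReal.ofReal l < maximalFn f x},
            ENNReal.ofReal (1 / Real.log l)) := lintegral_mono fun x => PsiE_le x _
    _ = ENNReal.ofReal (Real.exp 1) * volume s + _ := by
        rw [lintegral_add_left measurable_const, setLIntegral_const]
    _ < ⊤ := ENNReal.add_lt_top.2
        ⟨ENNReal.mul_lt_top ENNReal.ofReal_lt_top hs.lt_top, hmain⟩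

/-- If the maximal function of `f` is in `L_Ψ` on a ball supporting `f`, then `f` is in
`L log log L`. -/
lemma setLIntegral_logPlus_lt_top_of_PsiE (hd : 1 ≤ d) {f : 𝔼 → ℂ} (hf : Measurable f)
    {x₀ : 𝔼} {R : ℝ} (hR : 0 < R) (hsupp : Function.support f ⊆ closedBall x₀ R)
    (h : ∫⁻ x in closedBall x₀ R, PsiE x (maximalFn f x) < ⊤) :
    ∫⁻ x in closedBall x₀ R, ENNReal.ofReal (‖f x‖ * logPlus (logPlus ‖f x‖)) < ⊤ := by
  have hk : Measurable fun l : ℝ => ENNReal.ofReal (1 / Real.log l) :=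
    (measurable_const.div Real.measurable_log).ennreal_ofReal
  have hk' : Measurable fun l : ℝ => ENNReal.ofReal (1 / (l * Real.log l)) :=
    (measurable_const.div (measurable_id.mul Real.measurable_log)).ennreal_ofReal
  have hM : Measurable (maximalFn f) := measurable_maximalFn f
  have hV0 : ∀ x : 𝔼, volume (closedBall x R) ≠ 0 := fun x =>
    (measure_closedBall_pos volume x hR).ne'
  have hVt : ∀ x : 𝔼, volume (closedBall x R) ≠ ⊤ := fun x => measure_closedBall_lt_top.ne
  have hfi : ∫⁻ x, ‖f x‖ₑ ≠ ⊤ := by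
    intro htop
    simp only [maximalFn_eq_top hR.le hsupp htop, PsiE_top, setLIntegral_const] at h
    rw [ENNReal.top_mul (hV0 x₀)] at h
    exact lt_irrefl _ h
  set B := closedBall x₀ R
  set a₀ : ℝ≥0∞ := (∫⁻ x, ‖f x‖ₑ) / volume (closedBall (0 : 𝔼) R)
  have ha₀t : a₀ ≠ ⊤ := (ENNReal.div_lt_top hfi (hV0 0)).ne
  set L : ℝ := max (Real.exp 2) a₀.toReal
  have hL2 : Real.exp 2 ≤ L := le_max_left _ _
  have hL1 : Real.exp 1 ≤ L := (Real.exp_le_exp.2 (by norm_num)).trans hL2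
  have hL0 : 0 < L := (Real.exp_pos _).trans_le hL2
  have hρ : ∀ x ∈ B, ‖x‖ ≤ ‖x₀‖ + R := fun x hx => by
    have : ‖x - x₀‖ ≤ R := by rw [← dist_eq_norm]; exact hx
    linarith [norm_le_norm_add_norm_sub' x x₀]
  have h3 : (1 : ℝ) ≤ 3 ^ d := one_le_pow₀ (by norm_num)
  set K : ℝ≥0∞ :=
    ENNReal.ofReal (2 * 3 ^ d * (2 + Real.log (Real.exp 1 + (‖x₀‖ + R))))
  set A : ℝ≥0∞ := ENNReal.ofReal (16 ^ d)
  have hmain : ∫⁻ x in B, (‖f x‖ₑ * ∫⁻ l in Ioi L ∩ {l | ENNReal.ofReal l < ‖f x‖ₑ},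
      ENNReal.ofReal (1 / (l * Real.log l))) < ⊤ := by
    calc ∫⁻ x in B, (‖f x‖ₑ * ∫⁻ l in Ioi L ∩ {l | ENNReal.ofReal l < ‖f x‖ₑ},
          ENNReal.ofReal (1 / (l * Real.log l)))
        = ∫⁻ l in Ioi L, ENNReal.ofReal (1 / (l * Real.log l)) *
            ∫⁻ x in {x | ENNReal.ofReal l < ‖f x‖ₑ}, ‖f x‖ₑ ∂(volume.restrict B) :=
          lintegral_mul_setLIntegral_superlevel _ hf.enorm hf.enorm hk' L
      _ ≤ ∫⁻ l in Ioi L, A * (ENNReal.ofReal (1 / Real.log l) *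
            ∫⁻ x in {x | ENNReal.ofReal l < ENNReal.ofReal (3 ^ d) * maximalFn f x}, 1
              ∂(volume.restrict B)) := by
          refine setLIntegral_mono' measurableSet_Ioi fun l hl => ?_
          have hl0 : 0 < l := hL0.trans hl
          have hla : ∫⁻ x, ‖f x‖ₑ ≤ ENNReal.ofReal l * volume (closedBall (0 : 𝔼) R) := by
            rw [← ENNReal.div_le_iff (hV0 0) (hVt 0)]
            exact (ENNReal.le_ofReal_iff_toReal_le ha₀t hl0.le).2
              ((le_max_right _ _).trans (le_of_lt hl))
          have hrev := setLIntegral_le_mul_volume_inter hf.enorm hfi x₀ hR hla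
            (T := {x | ENNReal.ofReal l < ENNReal.ofReal (3 ^ d) * maximalFn f x})
            fun x r hr hx => closedBall_subset_lt_maximalFn hd f hr hx
          have hfac : ENNReal.ofReal (1 / Real.log l) =
              ENNReal.ofReal (1 / (l * Real.log l)) * ENNReal.ofReal l := by
            rw [← ENNReal.ofReal_mul' hl0.le]
            congr 1
            field_simp
          rw [Measure.restrict_restrict (measurableSet_lt measurable_const hf.enorm),
            Measure.restrict_restrict (measurableSet_lt measurable_const (hM.const_mul _)),
            setLIntegral_one, inter_comm _ B, inter_comm _ B, hfac, mul_assoc, mul_left_comm A]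
          gcongr
      _ = A * ∫⁻ x in B, 1 * ∫⁻ l in Ioi L ∩
            {l | ENNReal.ofReal l < ENNReal.ofReal (3 ^ d) * maximalFn f x},
            ENNReal.ofReal (1 / Real.log l) := by
          rw [lintegral_const_mul' _ _ ENNReal.ofReal_ne_top,
            lintegral_mul_setLIntegral_superlevel _ (hM.const_mul _) measurable_const hk]
      _ ≤ A * ∫⁻ x in B, K * PsiE x (maximalFn f x) := by
          gcongr A * ?_
          refine setLIntegral_mono' measurableSet_closedBall fun x hx => ?_
          rw [one_mul]
          exact le_PsiE h3 hL2 (hρ x hx) _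
      _ = A * (K * ∫⁻ x in B, PsiE x (maximalFn f x)) := by
          rw [lintegral_const_mul' _ _ ENNReal.ofReal_ne_top]
      _ < ⊤ := ENNReal.mul_lt_top ENNReal.ofReal_lt_top
          (ENNReal.mul_lt_top ENNReal.ofReal_lt_top h)
  calc ∫⁻ x in B, ENNReal.ofReal (‖f x‖ * logPlus (logPlus ‖f x‖))
      ≤ ∫⁻ x in B, (‖f x‖ₑ * ENNReal.ofReal (Real.log (Real.log L)) +
          ‖f x‖ₑ * ∫⁻ l in Ioi L ∩ {l | ENNReal.ofReal l < ‖f x‖ₑ},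
            ENNReal.ofReal (1 / (l * Real.log l))) := by
        refine lintegral_mono fun x => ?_
        have := ofReal_logPlus_logPlus_le hL1 (norm_nonneg (f x))
        rw [ofReal_norm] at this
        rw [← mul_add, ENNReal.ofReal_mul (norm_nonneg _), ofReal_norm]
        gcongr
    _ = (∫⁻ x in B, ‖f x‖ₑ) * ENNReal.ofReal (Real.log (Real.log L)) + _ := by
        rw [lintegral_add_left (hf.enorm.mul_const _),
          lintegral_mul_const _ hf.enorm]
    _ < ⊤ := ENNReal.add_lt_top.2 ⟨ENNReal.mul_lt_top
        ((setLIntegral_le_lintegral _ _).trans_lt hfi.lt_top) ENNReal.ofReal_lt_top, hmain⟩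

end MaximalFunction

/-- Stein-type theorem for `L_Ψ`: for `f` supported in a closed ball `B`,
`M(f) ∈ L_Ψ(B)` iff `f ∈ L log log L (B)`. -/
theorem stmt0 {d : ℕ} (hd : 1 ≤ d) (x₀ : EuclideanSpace ℝ (Fin d)) (R : ℝ) (hR : 0 ≤ R)
    (f : EuclideanSpace ℝ (Fin d) → ℂ) (hf : Measurable f)
    (hsupp : Function.support f ⊆ closedBall x₀ R) :
    (∫⁻ x in closedBall x₀ R, PsiE x (maximalFn f x)) < ⊤ ↔
      (∫⁻ x in closedBall x₀ R,
        ENNReal.ofReal (‖f x‖ * logPlus (logPlus ‖f x‖))) < ⊤ := by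
  rcases hR.eq_or_lt with rfl | hR
  · have : Nonempty (Fin d) := ⟨⟨0, hd⟩⟩
    have h0 : (volume : Measure (EuclideanSpace ℝ (Fin d))).restrict (closedBall x₀ 0) = 0 := by
      simp
    simp only [h0, lintegral_zero_measure]
  · exact ⟨setLIntegral_logPlus_lt_top_of_PsiE hd hf hR hsupp,
      setLIntegral_PsiE_maximalFn_lt_top hd hf measure_closedBall_lt_top.ne hsupp⟩
end

section
/- Let B be the closed unit ball of ℝ^d and let f be an integrable function supported in B with ∫_B f(y) dy = 0 and ∫_B |f(x)| log⁺ log⁺ |f(x)| dx < ∞. Then f belongs to H^log(ℝ^d), i.e. ∫_{ℝ^d} Ψ(x, M_φ(f)(x)) dx < ∞. -/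
open MeasureTheory Metric ENNReal

/-- The smooth maximal function `M_φ f (x) = sup_{ε>0} |(f ∗ φ_ε)(x)|`, where
`φ_ε(x) = ε^{-d} φ(x/ε)`. -/
noncomputable def MphiFn {d : ℕ} (φ : EuclideanSpace ℝ (Fin d) → ℝ)
    (f : EuclideanSpace ℝ (Fin d) → ℝ) (x : EuclideanSpace ℝ (Fin d)) : ℝ≥0∞ :=
  ⨆ (ε : ℝ) (_ : 0 < ε),
    ENNReal.ofReal |∫ y, f y * ((ε ^ d)⁻¹ * φ (ε⁻¹ • (x - y)))|


section Helpers

variable {d : ℕ}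

/-- A Vitali covering form of the Hardy–Littlewood weak type `(1,1)` inequality. -/
theorem weak_type_vitali (hd : 1 ≤ d) {g : EuclideanSpace ℝ (Fin d) → ℝ≥0∞}
    (hg : ∫⁻ y, g y ≠ ⊤) {l : ℝ} (hl : 0 < l) :
    ENNReal.ofReal l * volume {x : EuclideanSpace ℝ (Fin d) |
        ∃ r : ℝ, 0 < r ∧ ENNReal.ofReal (l * r ^ d) < ∫⁻ y in closedBall x r, g y} ≤
      volume (closedBall (0 : EuclideanSpace ℝ (Fin d)) 5) * ∫⁻ y, g y := by
  set S := {x : EuclideanSpace ℝ (Fin d) |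
        ∃ r : ℝ, 0 < r ∧ ENNReal.ofReal (l * r ^ d) < ∫⁻ y in closedBall x r, g y} with hS
  have hex : ∀ x : EuclideanSpace ℝ (Fin d), ∃ r : ℝ, x ∈ S →
      (0 < r ∧ ENNReal.ofReal (l * r ^ d) < ∫⁻ y in closedBall x r, g y) := by
    intro x
    by_cases hx : x ∈ S
    · obtain ⟨r, hr⟩ := hx
      exact ⟨r, fun _ => hr⟩
    · exact ⟨0, fun h => absurd h hx⟩
  choose r hr using hex
  have hR : ∀ a ∈ S, r a ≤ max 1 ((∫⁻ y, g y).toReal / l) := by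
    intro a ha
    obtain ⟨h0, h1⟩ := hr a ha
    rcases le_total (r a) 1 with h | h
    · exact le_max_of_le_left h
    · refine le_max_of_le_right ?_
      have h2 : ENNReal.ofReal (l * r a ^ d) < ∫⁻ y, g y :=
        h1.trans_le (setLIntegral_le_lintegral _ _)
      have h3 : l * r a ^ d < (∫⁻ y, g y).toReal :=
        (ENNReal.ofReal_lt_iff_lt_toReal (by positivity) hg).1 h2
      have h4 : r a ≤ r a ^ d := le_self_pow₀ h (by omega)
      rw [le_div_iff₀ hl]
      nlinarith
  obtain ⟨u, huS, hdisj, hcov⟩ := Vitali.exists_disjoint_subfamily_covering_enlargement_closedBall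
    S (fun x => x) r _ hR 5 (by norm_num)
  have hcount : u.Countable := by
    refine hdisj.countable_of_nonempty_interior fun a ha => ?_
    exact ⟨a, ball_subset_interior_closedBall (mem_ball_self (hr a (huS ha)).1)⟩
  have hsub : S ⊆ ⋃ a ∈ u, closedBall a (5 * r a) := by
    intro a ha
    obtain ⟨b, hb, hab⟩ := hcov a ha
    exact Set.mem_biUnion hb (hab (mem_closedBall_self (hr a ha).1.le))
  calc ENNReal.ofReal l * volume S
      ≤ ENNReal.ofReal l * ∑' a : u, volume (closedBall (a : EuclideanSpace ℝ (Fin d)) (5 * r a)) := by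
        gcongr
        exact (measure_mono hsub).trans (measure_biUnion_le _ hcount _)
    _ = ∑' a : u, ENNReal.ofReal l *
          volume (closedBall (a : EuclideanSpace ℝ (Fin d)) (5 * r a)) := ENNReal.tsum_mul_left.symm
    _ ≤ ∑' a : u, volume (closedBall (0 : EuclideanSpace ℝ (Fin d)) 5) *
          ∫⁻ y in closedBall (a : EuclideanSpace ℝ (Fin d)) (r a), g y := by
        refine ENNReal.tsum_le_tsum fun a => ?_
        obtain ⟨h0, h1⟩ := hr a (huS a.2)
        rw [Measure.addHaar_closedBall _ _ (by positivity),
          Measure.addHaar_closedBall _ _ (by norm_num : (0 : ℝ) ≤ 5), finrank_euclideanSpace_fin,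
          mul_pow, ENNReal.ofReal_mul (by positivity)]
        rw [ENNReal.ofReal_mul hl.le] at h1
        calc _ = ENNReal.ofReal (5 ^ d) * volume (ball (0 : EuclideanSpace ℝ (Fin d)) 1) *
              (ENNReal.ofReal l * ENNReal.ofReal (r a ^ d)) := by ring
          _ ≤ _ := by gcongr
    _ = volume (closedBall (0 : EuclideanSpace ℝ (Fin d)) 5) *
          ∫⁻ y in ⋃ a ∈ u, closedBall a (r a), g y := by
        rw [ENNReal.tsum_mul_left,
          lintegral_biUnion hcount (fun _ _ => measurableSet_closedBall) hdisj]
    _ ≤ _ := by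
        gcongr
        exact Measure.restrict_le_self

theorem lintegral_dilate_eq_one {φ : EuclideanSpace ℝ (Fin d) → ℝ}
    (hφc : Continuous φ) (hφs : HasCompactSupport φ) (hφnonneg : ∀ x, 0 ≤ φ x)
    (hφint : ∫ x, φ x = 1) {ε : ℝ} (hε : 0 < ε) (x : EuclideanSpace ℝ (Fin d)) :
    ∫⁻ y, ENNReal.ofReal ((ε ^ d)⁻¹ * φ (ε⁻¹ • (x - y))) = 1 := by
  have hi : Integrable φ := hφc.integrable_of_hasCompactSupport hφs
  have h1 : Integrable (fun y => φ (ε⁻¹ • (x - y))) :=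
    (hi.comp_smul (inv_ne_zero hε.ne')).comp_sub_left x
  rw [← ofReal_integral_eq_lintegral_ofReal (h1.const_mul _)
    (ae_of_all _ fun y => mul_nonneg (by positivity) (hφnonneg _)), integral_const_mul,
    integral_sub_left_eq_self (fun z => φ (ε⁻¹ • z)) volume x,
    Measure.integral_comp_inv_smul_of_nonneg volume φ hε.le, hφint, finrank_euclideanSpace_fin]
  simp [hε.ne']

/-- Where the smooth maximal function exceeds `2τ`, some ball average of `|f| 1_{|f| > τ}` is
large. -/
theorem exists_ball_of_lt_MphiFn {φ f : EuclideanSpace ℝ (Fin d) → ℝ}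
    (hφc : Continuous φ) (hφnonneg : ∀ x, 0 ≤ φ x)
    (hφsupp : Function.support φ ⊆ closedBall 0 1) (hφint : ∫ x, φ x = 1)
    {K : ℝ} (hK : 0 < K) (hφK : ∀ x, φ x ≤ K) {τ : ℝ} (hτ : 0 < τ)
    {x : EuclideanSpace ℝ (Fin d)} (hx : ENNReal.ofReal (2 * τ) < MphiFn φ f x) :
    ∃ r : ℝ, 0 < r ∧ ENNReal.ofReal (τ / K * r ^ d) <
      ∫⁻ y in closedBall x r, (Set.Ioi τ).indicator ENNReal.ofReal |f y| := by
  simp only [MphiFn, lt_iSup_iff] at hx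
  obtain ⟨ε, hε, hx⟩ := hx
  refine ⟨ε, hε, ?_⟩
  have hφs : HasCompactSupport φ :=
    HasCompactSupport.of_support_subset_isCompact (isCompact_closedBall 0 1) hφsupp
  have hpt : ∀ y, ‖f y * ((ε ^ d)⁻¹ * φ (ε⁻¹ • (x - y)))‖ₑ ≤
      ENNReal.ofReal τ * ENNReal.ofReal ((ε ^ d)⁻¹ * φ (ε⁻¹ • (x - y))) +
      ENNReal.ofReal (K / ε ^ d) * (closedBall x ε).indicator
        (fun y => (Set.Ioi τ).indicator ENNReal.ofReal |f y|) y := by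
    intro y
    have hp : 0 ≤ (ε ^ d)⁻¹ * φ (ε⁻¹ • (x - y)) := mul_nonneg (by positivity) (hφnonneg _)
    rw [← ofReal_norm, norm_mul, Real.norm_of_nonneg hp, Real.norm_eq_abs,
      ENNReal.ofReal_mul (abs_nonneg _)]
    rcases le_or_gt |f y| τ with h | h
    · exact le_add_right (by gcongr)
    by_cases hy : y ∈ closedBall x ε
    · rw [Set.indicator_of_mem hy, Set.indicator_of_mem (show |f y| ∈ Set.Ioi τ from h), mul_comm]
      refine le_add_left ?_
      gcongr
      rw [div_eq_inv_mul]
      gcongr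
      exact hφK _
    · have : φ (ε⁻¹ • (x - y)) = 0 := by
        by_contra h0
        have h1 := hφsupp h0
        rw [mem_closedBall_zero_iff, norm_smul, Real.norm_of_nonneg (by positivity),
          inv_mul_le_iff₀ hε, mul_one] at h1
        exact hy (by rwa [mem_closedBall', dist_eq_norm])
      simp [this]
  have hint : ENNReal.ofReal |∫ y, f y * ((ε ^ d)⁻¹ * φ (ε⁻¹ • (x - y)))| ≤ ENNReal.ofReal τ +
      ENNReal.ofReal (K / ε ^ d) *
        ∫⁻ y in closedBall x ε, (Set.Ioi τ).indicator ENNReal.ofReal |f y| := by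
    rw [← Real.norm_eq_abs, ofReal_norm]
    refine (enorm_integral_le_lintegral_enorm _).trans ((lintegral_mono hpt).trans_eq ?_)
    rw [lintegral_add_left (by fun_prop), lintegral_const_mul _ (by fun_prop),
      lintegral_dilate_eq_one hφc hφs hφnonneg hφint hε, mul_one,
      lintegral_const_mul' _ _ ENNReal.ofReal_ne_top, lintegral_indicator measurableSet_closedBall]
  have h2 := hx.trans_le hint
  rw [two_mul, ENNReal.ofReal_add hτ.le hτ.le,
    ENNReal.add_lt_add_iff_left ENNReal.ofReal_ne_top] at h2
  by_contra! hcon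
  refine absurd h2 (not_lt.2 ?_)
  calc _ ≤ ENNReal.ofReal (K / ε ^ d) * ENNReal.ofReal (τ / K * ε ^ d) := by gcongr
    _ = ENNReal.ofReal τ := by
      rw [← ENNReal.ofReal_mul (by positivity)]
      congr 1
      field_simp

theorem log_add_one_le_log_add_log (t : ℝ) (x : EuclideanSpace ℝ (Fin d)) :
    Real.log (Real.exp 1 + t) + 1 ≤
      Real.log (Real.exp 1 + t) + Real.log (Real.exp 1 + ‖x‖) := by
  gcongr
  rw [Real.le_log_iff_exp_le (by positivity)]
  linarith [norm_nonneg x]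

theorem PsiE_le_self (x : EuclideanSpace ℝ (Fin d)) (t : ℝ≥0∞) : PsiE x t ≤ t := by
  refine ENNReal.div_le_of_le_mul (le_mul_of_one_le_right' ?_)
  rw [ENNReal.one_le_ofReal]
  have h := log_add_one_le_log_add_log t.toReal x
  have : 0 ≤ Real.log (Real.exp 1 + t.toReal) :=
    Real.log_nonneg (by linarith [Real.add_one_le_exp 1, @ENNReal.toReal_nonneg t])
  linarith

theorem PsiE_le_dyadic (x : EuclideanSpace ℝ (Fin d)) (t : ℝ≥0∞) :
    PsiE x t ≤ 1 + ∑' k : ℕ, ENNReal.ofReal (6 * 2 ^ k / (k + 1)) *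
      (Set.Ioi (ENNReal.ofReal (2 ^ k))).indicator 1 t := by
  rcases le_or_gt t 1 with h1 | h1
  · exact ((PsiE_le_self x t).trans h1).trans le_self_add
  refine le_add_left ?_
  rcases eq_or_ne t ⊤ with rfl | ht
  · refine le_top.trans_eq (Eq.symm (top_le_iff.1 ?_))
    rw [← ENNReal.tsum_const_eq_top_of_ne_zero (α := ℕ) (one_ne_zero)]
    refine ENNReal.tsum_le_tsum fun k => ?_
    rw [Set.indicator_of_mem (by simp), Pi.one_apply, mul_one, ENNReal.one_le_ofReal,
      one_le_div (by positivity)]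
    have : ((k + 1 : ℕ) : ℝ) ≤ ((2 ^ k : ℕ) : ℝ) := by exact_mod_cast Nat.lt_two_pow_self
    push_cast at this
    nlinarith [pow_pos (two_pos : (0:ℝ) < 2) k]
  lift t to NNReal using ht
  have h1' : (1 : ℝ) < t := by exact_mod_cast h1
  obtain ⟨k, hk1, hk2⟩ : ∃ k : ℕ, (2 : ℝ) ^ k < t ∧ (t : ℝ) ≤ 2 ^ (k + 1) := by
    obtain ⟨n, hn, hn'⟩ := exists_nat_pow_near_of_lt_one (inv_pos.2 (one_pos.trans h1'))
      (inv_le_one_of_one_le₀ h1'.le) (by norm_num : (0 : ℝ) < 2⁻¹) (by norm_num)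
    rcases hn'.lt_or_eq with h | h
    · rw [inv_pow] at h hn
      refine ⟨n, (inv_lt_inv₀ (by positivity) (by positivity)).1 h,
        ((inv_lt_inv₀ (by positivity) (by positivity)).1 hn).le⟩
    · rw [inv_pow, inv_inj] at h
      cases n with
      | zero => simp [h] at h1'
      | succ m => exact ⟨m, by rw [h]; gcongr <;> simp, h.le⟩
  refine le_trans ?_ (ENNReal.le_tsum k)
  have hmem : (t : ℝ≥0∞) ∈ Set.Ioi (ENNReal.ofReal (2 ^ k)) := by
    rw [Set.mem_Ioi, ENNReal.ofReal_lt_coe_iff (by positivity)]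
    exact hk1
  rw [Set.indicator_of_mem hmem, Pi.one_apply, mul_one, PsiE, ENNReal.coe_toReal]
  have hlog : ((k : ℝ) + 1) / 3 ≤
      Real.log (Real.exp 1 + t) + Real.log (Real.exp 1 + ‖x‖) := by
    have h := log_add_one_le_log_add_log (t : ℝ) x
    have h2 : k * Real.log 2 ≤ Real.log (Real.exp 1 + t) := by
      rw [← Real.log_pow]
      exact Real.log_le_log (by positivity) (by linarith [Real.exp_pos 1])
    have := Real.log_two_gt_d9
    have hk : (0 : ℝ) ≤ k := k.cast_nonneg
    nlinarith
  have hk3 : (0 : ℝ) < ((k : ℝ) + 1) / 3 := by positivity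
  rw [← ENNReal.ofReal_coe_nnreal, ← ENNReal.ofReal_div_of_pos (hk3.trans_le hlog)]
  refine ENNReal.ofReal_le_ofReal ?_
  calc (t : ℝ) / _ ≤ 2 ^ (k + 1) / (((k : ℝ) + 1) / 3) := by gcongr
    _ = _ := by rw [pow_succ]; field_simp; norm_num

theorem tsum_dyadic_le (s : ℝ) :
    ∑' k : ℕ, ENNReal.ofReal (1 / ((k : ℝ) + 1)) *
        (Set.Ioi ((2 : ℝ) ^ k / 2)).indicator ENNReal.ofReal s ≤
      ENNReal.ofReal (3 * s) + ENNReal.ofReal (s * logPlus (logPlus s)) := by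
  rcases le_or_gt s (1 / 2) with hs | hs
  · refine le_of_eq_of_le ?_ zero_le
    rw [ENNReal.tsum_eq_zero]
    intro k
    rw [Set.indicator_of_notMem, mul_zero]
    have : (1 : ℝ) ≤ 2 ^ k := one_le_pow₀ (by norm_num)
    simp only [Set.mem_Ioi, not_lt]
    linarith
  have hs0 : 0 < s := by linarith
  set u := logPlus s with hu
  have hu0 : 0 ≤ u := le_max_right _ _
  set N : ℕ := ⌊2 + 2 * u⌋₊ with hN
  have hN1 : (1 : ℝ) ≤ N := by
    have : 1 ≤ N := Nat.le_floor (by push_cast; linarith)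
    exact_mod_cast this
  have hzero : ∀ k ∉ Finset.range N, ENNReal.ofReal (1 / ((k : ℝ) + 1)) *
        (Set.Ioi ((2 : ℝ) ^ k / 2)).indicator ENNReal.ofReal s = 0 := by
    intro k hk
    rw [Set.indicator_of_notMem, mul_zero]
    intro hks
    simp only [Set.mem_Ioi] at hks
    apply hk
    rw [Finset.mem_range, ← Nat.add_one_le_iff]
    apply Nat.le_floor
    have h1 : k * Real.log 2 ≤ Real.log 2 + Real.log s := by
      rw [← Real.log_pow, ← Real.log_mul (by norm_num) hs0.ne']
      exact Real.log_le_log (by positivity) (by linarith)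
    have h2 : Real.log s ≤ u := le_max_left _ _
    have := Real.log_two_gt_d9
    push_cast
    nlinarith
  rw [tsum_eq_sum hzero]
  have hlogN : Real.log N ≤ 2 + logPlus u := by
    have h4 : Real.log 4 ≤ 2 := by
      rw [show (4 : ℝ) = 2 ^ 2 by norm_num, Real.log_pow]
      have := Real.log_two_lt_d9
      push_cast
      linarith
    have hNle : (N : ℝ) ≤ 2 + 2 * u := Nat.floor_le (by linarith)
    rcases le_total u 1 with h | h
    · have : Real.log N ≤ Real.log 4 := Real.log_le_log (by linarith) (by linarith)
      have : 0 ≤ logPlus u := le_max_right _ _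
      linarith
    · have h5 : Real.log N ≤ Real.log (4 * u) := Real.log_le_log (by linarith) (by linarith)
      rw [Real.log_mul (by norm_num) (by linarith)] at h5
      have : Real.log u ≤ logPlus u := le_max_left _ _
      linarith
  calc _ ≤ ∑ k ∈ Finset.range N, ENNReal.ofReal (1 / ((k : ℝ) + 1)) * ENNReal.ofReal s := by
        gcongr with k
        exact Set.indicator_le_self _ _ _
    _ = ENNReal.ofReal ((harmonic N : ℚ) * s) := by
        rw [← Finset.sum_mul, ← ENNReal.ofReal_sum_of_nonneg (fun _ _ => by positivity),
          ← ENNReal.ofReal_mul (Finset.sum_nonneg fun _ _ => by positivity)]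
        simp [harmonic]
    _ ≤ ENNReal.ofReal (3 * s + s * logPlus u) := by
        refine ENNReal.ofReal_le_ofReal ?_
        have := harmonic_le_one_add_log N
        nlinarith
    _ ≤ _ := ENNReal.ofReal_add_le

/-- Away from the unit ball, cancellation makes the smooth maximal function decay. -/
theorem MphiFn_le_of_two_lt_norm {φ f : EuclideanSpace ℝ (Fin d) → ℝ} {L : NNReal}
    (hφL : LipschitzWith L φ) (hφc : HasCompactSupport φ)
    (hφsupp : Function.support φ ⊆ closedBall 0 1) (hf : Integrable f)
    (hsupp : Function.support f ⊆ closedBall 0 1) (hmean : ∫ y, f y = 0)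
    {x : EuclideanSpace ℝ (Fin d)} (hx : 2 < ‖x‖) :
    MphiFn φ f x ≤ ENNReal.ofReal (L * 3 ^ (d + 1) * ∫ y, |f y|) *
      ENNReal.ofReal ((1 + ‖x‖) ^ (-((d : ℝ) + 1))) := by
  refine iSup₂_le fun ε hε => ?_
  rw [← ENNReal.ofReal_mul (mul_nonneg (by positivity) (integral_nonneg fun _ => abs_nonneg _))]
  refine ENNReal.ofReal_le_ofReal ?_
  have hcont : Continuous φ := hφL.continuous
  obtain ⟨K, hK⟩ := hφc.exists_bound_of_continuous hcont
  have hint : Integrable (fun y => f y * φ (ε⁻¹ • (x - y))) :=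
    hf.mul_bdd (c := K) (by fun_prop) (ae_of_all _ fun y => hK _)
  have hvan : ∀ z : EuclideanSpace ℝ (Fin d), ε < ‖z‖ → φ (ε⁻¹ • z) = 0 := by
    intro z hz
    by_contra h0
    have h1 := hφsupp h0
    rw [mem_closedBall_zero_iff, norm_smul, Real.norm_of_nonneg (by positivity),
      inv_mul_le_iff₀ hε, mul_one] at h1
    linarith
  have hrw : ∫ y, f y * ((ε ^ d)⁻¹ * φ (ε⁻¹ • (x - y))) =
      ∫ y, (ε ^ d)⁻¹ * (f y * (φ (ε⁻¹ • (x - y)) - φ (ε⁻¹ • x))) := by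
    have h1 : ∫ y, f y * φ (ε⁻¹ • x) = 0 := by rw [integral_mul_const, hmean, zero_mul]
    simp only [mul_sub]
    rw [integral_sub (hint.const_mul _) ((hf.mul_const _).const_mul _),
      integral_const_mul _ (fun y => f y * φ (ε⁻¹ • x)), h1,
      mul_zero, sub_zero]
    congr 1
    ext y
    ring
  have hmain : ∀ y, ‖(ε ^ d)⁻¹ * (f y * (φ (ε⁻¹ • (x - y)) - φ (ε⁻¹ • x)))‖ ≤
      L * 3 ^ (d + 1) * ((1 + ‖x‖) ^ (d + 1))⁻¹ * |f y| := by
    intro y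
    by_cases hy : f y = 0
    · simp [hy]
    have hy1 : ‖y‖ ≤ 1 := by simpa using hsupp hy
    have hxy : ‖x‖ - 1 ≤ ‖x - y‖ := by linarith [norm_sub_norm_le x y]
    rcases lt_or_ge ε (‖x‖ - 1) with h | h
    · rw [hvan _ (h.trans_le hxy), hvan x (by linarith)]
      simp only [sub_zero, mul_zero, norm_zero]
      positivity
    have hd1 : |φ (ε⁻¹ • (x - y)) - φ (ε⁻¹ • x)| ≤ L * ε⁻¹ := by
      have h1 := hφL.dist_le_mul (ε⁻¹ • (x - y)) (ε⁻¹ • x)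
      rw [dist_eq_norm, dist_eq_norm, ← smul_sub, norm_smul, Real.norm_eq_abs,
        Real.norm_of_nonneg (by positivity), sub_sub_cancel_left, norm_neg] at h1
      refine h1.trans ?_
      gcongr
      exact mul_le_of_le_one_right (by positivity) hy1
    have hε3 : (1 + ‖x‖) / 3 ≤ ε := by linarith
    rw [norm_mul, norm_mul, Real.norm_of_nonneg (by positivity), Real.norm_eq_abs,
      Real.norm_eq_abs]
    calc (ε ^ d)⁻¹ * (|f y| * |φ (ε⁻¹ • (x - y)) - φ (ε⁻¹ • x)|)
        ≤ (ε ^ d)⁻¹ * (|f y| * (L * ε⁻¹)) := by gcongr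
      _ = L * (ε ^ (d + 1))⁻¹ * |f y| := by rw [pow_succ, mul_inv]; ring
      _ ≤ L * (((1 + ‖x‖) / 3) ^ (d + 1))⁻¹ * |f y| := by gcongr
      _ = _ := by rw [div_pow, inv_div]; ring
  rw [hrw, ← Real.norm_eq_abs]
  refine (norm_integral_le_of_norm_le (hf.abs.const_mul _) (ae_of_all _ hmain)).trans_eq ?_
  rw [integral_const_mul, Real.rpow_neg (by positivity)]
  norm_cast
  ring

end Helpers

/-- Zygmund-type theorem for `H^log(ℝ^d)` : a mean-zero function in `L log log L` of the
closed unit ball belongs to `H^log(ℝ^d)`. -/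
theorem stmt1 {d : ℕ} (hd : 1 ≤ d)
    (φ : EuclideanSpace ℝ (Fin d) → ℝ) (c : ℝ)
    (hφsmooth : ContDiff ℝ (⊤ : ℕ∞) φ) (hφnonneg : ∀ x, 0 ≤ φ x)
    (hφsupp : Function.support φ ⊆ closedBall 0 1)
    (hφint : ∫ x, φ x = 1)
    (hφconst : ∀ x : EuclideanSpace ℝ (Fin d), ‖x‖ ≤ 1 / 2 → φ x = c)
    (f : EuclideanSpace ℝ (Fin d) → ℝ) (hf : Integrable f)
    (hsupp : Function.support f ⊆ closedBall 0 1)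
    (hmean : ∫ y, f y = 0)
    (hLloglogL : (∫⁻ x in closedBall (0 : EuclideanSpace ℝ (Fin d)) 1,
      ENNReal.ofReal (|f x| * logPlus (logPlus |f x|))) < ⊤) :
    (∫⁻ x, PsiE x (MphiFn φ f x)) < ⊤ := by
  have hφs : HasCompactSupport φ :=
    HasCompactSupport.of_support_subset_isCompact (isCompact_closedBall 0 1) hφsupp
  have hφc : Continuous φ := hφsmooth.continuous
  obtain ⟨L, hL⟩ := hφsmooth.lipschitzWith_of_hasCompactSupport hφs (by simp)
  obtain ⟨K₀, hK₀⟩ := hφs.exists_bound_of_continuous hφc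
  set K := max K₀ 1 with hKdef
  have hK : 0 < K := lt_max_of_lt_right one_pos
  have hφK : ∀ x, φ x ≤ K := fun x =>
    (le_abs_self _).trans ((hK₀ x).trans (le_max_left _ _))
  rw [← lintegral_add_compl _ (measurableSet_closedBall
    (x := (0 : EuclideanSpace ℝ (Fin d))) (ε := 2)), ENNReal.add_lt_top]
  constructor
  · set g : ℕ → EuclideanSpace ℝ (Fin d) → ℝ≥0∞ := fun k y =>
      (Set.Ioi ((2 : ℝ) ^ k / 2)).indicator ENNReal.ofReal |f y| with hg
    have hgm : ∀ k, AEMeasurable (g k) := fun k =>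
      (ENNReal.measurable_ofReal.indicator measurableSet_Ioi).comp_aemeasurable
        hf.abs.aemeasurable
    have hfin : ∫⁻ y, ENNReal.ofReal |f y| ≠ ⊤ := hf.abs.lintegral_lt_top.ne
    have hgfin : ∀ k, ∫⁻ y, g k y ≠ ⊤ := fun k =>
      ne_top_of_le_ne_top hfin (lintegral_mono fun y => Set.indicator_le_self _ _ _)
    set E : ℕ → Set (EuclideanSpace ℝ (Fin d)) := fun k =>
      {x | ENNReal.ofReal (2 ^ k) < MphiFn φ f x} with hE
    set V := volume (closedBall (0 : EuclideanSpace ℝ (Fin d)) 5) with hV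
    have hVfin : V ≠ ⊤ := measure_closedBall_lt_top.ne
    have hweak : ∀ k, ENNReal.ofReal (2 ^ k / 2 / K) * volume (E k) ≤ V * ∫⁻ y, g k y := by
      intro k
      refine le_trans (mul_le_mul_right (measure_mono fun x hx => ?_) _)
        (weak_type_vitali hd (hgfin k) (show (0 : ℝ) < 2 ^ k / 2 / K by positivity))
      refine exists_ball_of_lt_MphiFn hφc hφnonneg hφsupp hφint hK hφK (by positivity) ?_
      rwa [mul_div_cancel₀ _ (two_ne_zero)]
    have hterm : ∀ k : ℕ, ENNReal.ofReal (6 * 2 ^ k / (k + 1)) * volume (E k) ≤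
        (ENNReal.ofReal (12 * K) * V) * ∫⁻ y, ENNReal.ofReal (1 / ((k : ℝ) + 1)) * g k y := by
      intro k
      rw [lintegral_const_mul' _ _ ENNReal.ofReal_ne_top]
      calc ENNReal.ofReal (6 * 2 ^ k / (k + 1)) * volume (E k)
          = ENNReal.ofReal (12 * K) * ENNReal.ofReal (1 / ((k : ℝ) + 1)) *
            (ENNReal.ofReal (2 ^ k / 2 / K) * volume (E k)) := by
            rw [← mul_assoc, ← ENNReal.ofReal_mul (by positivity),
              ← ENNReal.ofReal_mul (by positivity)]
            congr 2
            field_simp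
            norm_num
        _ ≤ ENNReal.ofReal (12 * K) * ENNReal.ofReal (1 / ((k : ℝ) + 1)) *
            (V * ∫⁻ y, g k y) := mul_le_mul_right (hweak k) _
        _ = _ := by ring
    have hsupp0 : ∫⁻ x, ENNReal.ofReal (|f x| * logPlus (logPlus |f x|)) =
        ∫⁻ x in closedBall (0 : EuclideanSpace ℝ (Fin d)) 1,
          ENNReal.ofReal (|f x| * logPlus (logPlus |f x|)) := by
      refine (setLIntegral_eq_of_support_subset ?_).symm
      intro x hx
      refine hsupp fun h0 => hx ?_
      simp [h0]
    have htot : ∑' k : ℕ, ENNReal.ofReal (6 * 2 ^ k / (k + 1)) * volume (E k) < ⊤ := by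
      calc _ ≤ ∑' k : ℕ, (ENNReal.ofReal (12 * K) * V) *
              ∫⁻ y, ENNReal.ofReal (1 / ((k : ℝ) + 1)) * g k y := ENNReal.tsum_le_tsum hterm
        _ = (ENNReal.ofReal (12 * K) * V) *
              ∫⁻ y, ∑' k : ℕ, ENNReal.ofReal (1 / ((k : ℝ) + 1)) * g k y := by
            rw [ENNReal.tsum_mul_left, lintegral_tsum fun k => (hgm k).const_mul _]
        _ ≤ (ENNReal.ofReal (12 * K) * V) * ∫⁻ y, (ENNReal.ofReal (3 * |f y|) +
              ENNReal.ofReal (|f y| * logPlus (logPlus |f y|))) := by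
            gcongr with y
            exact tsum_dyadic_le |f y|
        _ < ⊤ := by
            refine ENNReal.mul_lt_top (ENNReal.mul_lt_top ENNReal.ofReal_lt_top hVfin.lt_top) ?_
            rw [lintegral_add_left' (hf.abs.const_mul 3).aemeasurable.ennreal_ofReal, hsupp0]
            exact ENNReal.add_lt_top.2 ⟨(hf.abs.const_mul 3).lintegral_lt_top, hLloglogL⟩
    have hpt : ∀ x, PsiE x (MphiFn φ f x) ≤ 1 + ∑' k : ℕ,
        ENNReal.ofReal (6 * 2 ^ k / (k + 1)) * (toMeasurable volume (E k)).indicator 1 x := by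
      intro x
      refine (PsiE_le_dyadic x _).trans ?_
      gcongr with k
      by_cases hx : x ∈ E k
      · rw [Set.indicator_of_mem (subset_toMeasurable _ _ hx)]
        exact Set.indicator_le_self _ _ _
      · rw [Set.indicator_of_notMem (show MphiFn φ f x ∉ Set.Ioi _ from hx)]
        exact zero_le
    have hmeas : ∀ k : ℕ, Measurable fun x => ENNReal.ofReal (6 * 2 ^ k / (k + 1)) *
        (toMeasurable volume (E k)).indicator (1 : EuclideanSpace ℝ (Fin d) → ℝ≥0∞) x :=
      fun k => (measurable_one.indicator (measurableSet_toMeasurable _ _)).const_mul _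
    calc _ ≤ ∫⁻ x in closedBall (0 : EuclideanSpace ℝ (Fin d)) 2, (1 + ∑' k : ℕ,
        ENNReal.ofReal (6 * 2 ^ k / (k + 1)) *
          (toMeasurable volume (E k)).indicator 1 x) := lintegral_mono hpt
      _ ≤ volume (closedBall (0 : EuclideanSpace ℝ (Fin d)) 2) +
          ∑' k : ℕ, ENNReal.ofReal (6 * 2 ^ k / (k + 1)) * volume (E k) := by
        rw [lintegral_add_left measurable_const, setLIntegral_one]
        gcongr
        refine (setLIntegral_le_lintegral _ _).trans_eq ?_
        rw [lintegral_tsum fun k => (hmeas k).aemeasurable]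
        congr 1
        ext k
        rw [lintegral_const_mul' _ _ ENNReal.ofReal_ne_top,
          lintegral_indicator_one (measurableSet_toMeasurable _ _), measure_toMeasurable]
      _ < ⊤ := ENNReal.add_lt_top.2 ⟨measure_closedBall_lt_top, htot⟩
  · calc _ ≤ ∫⁻ x in (closedBall (0 : EuclideanSpace ℝ (Fin d)) 2)ᶜ,
          ENNReal.ofReal (L * 3 ^ (d + 1) * ∫ y, |f y|) *
            ENNReal.ofReal ((1 + ‖x‖) ^ (-((d : ℝ) + 1))) := by
          refine setLIntegral_mono' measurableSet_closedBall.compl fun x hx => ?_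
          refine (PsiE_le_self x _).trans
            (MphiFn_le_of_two_lt_norm hL hφs hφsupp hf hsupp hmean ?_)
          simpa using hx
      _ ≤ ∫⁻ x, ENNReal.ofReal (L * 3 ^ (d + 1) * ∫ y, |f y|) *
            ENNReal.ofReal ((1 + ‖x‖) ^ (-((d : ℝ) + 1))) := setLIntegral_le_lintegral _ _
      _ < ⊤ := by
          rw [lintegral_const_mul' _ _ ENNReal.ofReal_ne_top]
          exact ENNReal.mul_lt_top ENNReal.ofReal_lt_top
            (finite_integral_one_add_norm (by simp))
end

section
/- There exists an absolute constant C₀ > 0 with the following property. Let f ∈ L¹(𝕋) satisfy ∫_𝕋 f dθ = 0 and have a finite Haar expansion, i.e. f = Σ_{I∈𝓘} ⟨f,h_I⟩ h_I with only finitely many coefficients ⟨f,h_I⟩ nonzero. Then there exist finitely many functions β₁, …, β_N ∈ L^∞(𝕋), each β_k supported in some dyadic arc I_k ∈ 𝓘 and satisfying ∫_{I_k} β_k dθ = 0, such that f = Σ_{k=1}^N β_k and inf{ λ > 0 : Σ_{k=1}^N |I_k| Ψ₀(λ^{-1} ‖β_k‖_{L^∞(𝕋)}) ≤ 1 } ≤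 C₀ · inf{ λ > 0 : (2π)^{-1} ∫_𝕋 Ψ₀(λ^{-1} S_𝓘[f](θ)) dθ ≤ 1 }. -/
open MeasureTheory Real Set ENNReal

noncomputable section

/-- `Ψ₀(t) = t / log(e+t)`. -/
def psi0 (t : ℝ) : ℝ := t / Real.log (Real.exp 1 + t)

/-- `Ψ₀` on `[0,∞]`, with `Ψ₀(∞) = ∞`. -/
def psi0E (t : ℝ≥0∞) : ℝ≥0∞ := t / ENNReal.ofReal (Real.log (Real.exp 1 + t.toReal))

/-- The length `2π·2^{-k}` of a dyadic arc of generation `k`. -/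
def arcLen (k : ℕ) : ℝ := 2 * π / 2 ^ k

/-- The left endpoint `2π(2^{-k} m + δ)` of the dyadic arc `I = I^δ(k,m)`. -/
def arcStart (δ : ℝ) (k m : ℕ) : ℝ := 2 * π * ((m : ℝ) / 2 ^ k + δ)

/-- The dyadic arc `I^δ(k,m) = [2π(2^{-k}m + δ), 2π(2^{-k}(m+1) + δ))`. -/
def arc (δ : ℝ) (k m : ℕ) : Set ℝ := Ico (arcStart δ k m) (arcStart δ k m + arcLen k)

/-- The Haar function `h_I = |I|^{-1/2}(χ_{I_-} - χ_{I_+})` of the arc `I^δ(k,m)`. -/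
def haar (δ : ℝ) (k m : ℕ) : ℝ → ℝ := fun θ =>
  (arcLen k) ^ (-(1 : ℝ) / 2) *
    ((Ico (arcStart δ k m) (arcStart δ k m + arcLen k / 2)).indicator (fun _ => (1 : ℝ)) θ -
      (Ico (arcStart δ k m + arcLen k / 2) (arcStart δ k m + arcLen k)).indicator
        (fun _ => (1 : ℝ)) θ)

/-- The fundamental domain `[2πδ, 2πδ + 2π)` of the torus, containing all arcs of `𝓘^δ`. -/
def torus (δ : ℝ) : Set ℝ := Ico (2 * π * δ) (2 * π * δ + 2 * π)

/-- The Haar coefficient `⟨f, h_I⟩ = ∫_𝕋 f h_I dθ`. -/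
def haarCoeff (δ : ℝ) (k m : ℕ) (f : ℝ → ℝ) : ℝ := ∫ θ in torus δ, f θ * haar δ k m θ

/-- The dyadic square function `S_𝓘[f] = (Σ_{I∈𝓘} |⟨f,h_I⟩|² χ_I/|I|)^{1/2}` (valued in `[0,∞]`). -/
def sqFn (δ : ℝ) (f : ℝ → ℝ) (θ : ℝ) : ℝ≥0∞ :=
  (∑' (k : ℕ) (m : Fin (2 ^ k)),
      (‖haarCoeff δ k m f‖₊ : ℝ≥0∞) ^ 2 *
        (arc δ k m).indicator (fun _ => (ENNReal.ofReal (arcLen k))⁻¹) θ) ^ (1 / 2 : ℝ)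

/-- The `L^∞` norm (essential supremum of `|f|`), valued in `[0,∞]`. -/
def einfNorm (f : ℝ → ℝ) : ℝ≥0∞ := essSup (fun θ => (‖f θ‖₊ : ℝ≥0∞)) volume

/-- The average `⟨b⟩_I = |I|⁻¹ ∫_I b` over the arc `I^δ(k,m)`. -/
def arcAvg (δ : ℝ) (k m : ℕ) (b : ℝ → ℝ) : ℝ := (arcLen k)⁻¹ * ∫ θ in arc δ k m, b θ

/-- The dyadic `BMO⁺` norm, valued in `[0,∞]`. -/
def bmoNorm (δ : ℝ) (b : ℝ → ℝ) : ℝ≥0∞ :=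
  (⨆ (k : ℕ) (m : Fin (2 ^ k)),
      ((ENNReal.ofReal (arcLen k))⁻¹) ^ 2 *
        ∫⁻ θ in arc δ k m, (‖b θ - arcAvg δ k m b‖₊ : ℝ≥0∞) ^ 2) ^ (1 / 2 : ℝ) +
    ENNReal.ofReal |∫ θ in torus δ, b θ|

/-! ### The function `Ψ₀` -/

lemma one_le_log_exp_add {t : ℝ} (ht : 0 ≤ t) : 1 ≤ Real.log (Real.exp 1 + t) := by
  rw [Real.le_log_iff_exp_le (by positivity)]
  linarith

lemma psi0_nonneg {t : ℝ} (ht : 0 ≤ t) : 0 ≤ psi0 t :=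
  div_nonneg ht (by linarith [one_le_log_exp_add ht])

lemma psi0_le_self {t : ℝ} (ht : 0 ≤ t) : psi0 t ≤ t :=
  div_le_self ht (one_le_log_exp_add ht)

lemma psi0_mono {s t : ℝ} (hs : 0 ≤ s) (hst : s ≤ t) : psi0 s ≤ psi0 t := by
  have ht : 0 ≤ t := hs.trans hst
  have h1 := one_le_log_exp_add hs
  have h2 := one_le_log_exp_add ht
  have he := Real.exp_pos 1
  rw [psi0, psi0, div_le_div_iff₀ (by linarith) (by linarith)]
  have hlog : Real.log (Real.exp 1 + t) - Real.log (Real.exp 1 + s) ≤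
      (t - s) / (Real.exp 1 + s) := by
    rw [← Real.log_div (by positivity) (by positivity)]
    refine (Real.log_le_sub_one_of_pos (by positivity)).trans (le_of_eq ?_)
    field_simp
    ring
  have hs1 : s * ((t - s) / (Real.exp 1 + s)) ≤ t - s := by
    rw [mul_div_assoc', div_le_iff₀ (by positivity)]
    nlinarith
  nlinarith [mul_le_mul_of_nonneg_left hlog hs]

lemma psi0_two_mul_le {t : ℝ} (ht : 0 ≤ t) : psi0 (2 * t) ≤ 2 * psi0 t := by
  have h1 := one_le_log_exp_add ht
  rw [psi0, psi0, mul_div_assoc']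
  refine div_le_div_of_nonneg_left (by positivity) (by linarith) ?_
  exact Real.log_le_log (by positivity) (by linarith)

lemma psi0_le_mul_psi0_two_mul {t : ℝ} (ht : 0 ≤ t) : psi0 t ≤ 7 / 8 * psi0 (2 * t) := by
  have h1 := one_le_log_exp_add ht
  have h2 := one_le_log_exp_add (t := 2 * t) (by positivity)
  have he := Real.exp_pos 1
  have hlog : Real.log (Real.exp 1 + 2 * t) ≤ Real.log 2 + Real.log (Real.exp 1 + t) := by
    rw [← Real.log_mul (by norm_num) (by positivity)]
    exact Real.log_le_log (by positivity) (by linarith)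
  have hl2 := Real.log_two_lt_d9
  rw [psi0, psi0, mul_div_assoc', div_le_div_iff₀ (by linarith) (by linarith)]
  nlinarith

lemma psi0_le_pow_mul {t : ℝ} (ht : 0 ≤ t) (n : ℕ) :
    psi0 t ≤ (7 / 8 : ℝ) ^ n * psi0 (2 ^ n * t) := by
  induction n with
  | zero => simp
  | succ n ih =>
    have h := psi0_le_mul_psi0_two_mul (t := 2 ^ n * t) (by positivity)
    calc psi0 t ≤ (7 / 8 : ℝ) ^ n * psi0 (2 ^ n * t) := ih
      _ ≤ (7 / 8 : ℝ) ^ n * (7 / 8 * psi0 (2 * (2 ^ n * t))) := by gcongr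
      _ = _ := by rw [← mul_assoc, ← pow_succ, ← mul_assoc, ← pow_succ']

lemma psi0_pow_mul_le {t : ℝ} (ht : 0 ≤ t) (n : ℕ) : psi0 (2 ^ n * t) ≤ 2 ^ n * psi0 t := by
  induction n with
  | zero => simp
  | succ n ih =>
    calc psi0 (2 ^ (n + 1) * t) = psi0 (2 * (2 ^ n * t)) := by ring_nf
      _ ≤ 2 * psi0 (2 ^ n * t) := psi0_two_mul_le (by positivity)
      _ ≤ 2 * (2 ^ n * psi0 t) := by gcongr
      _ = _ := by ring

lemma psi0E_ofReal {t : ℝ} (ht : 0 ≤ t) :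
    psi0E (ENNReal.ofReal t) = ENNReal.ofReal (psi0 t) := by
  rw [psi0E, psi0, ENNReal.toReal_ofReal ht,
    ENNReal.ofReal_div_of_pos (by linarith [one_le_log_exp_add ht])]

lemma summable_pow_natAbs : Summable fun i : ℤ => (7 / 8 : ℝ) ^ i.natAbs := by
  have h : Summable fun n : ℕ => (7 / 8 : ℝ) ^ n :=
    summable_geometric_of_lt_one (by norm_num) (by norm_num)
  exact Summable.of_nat_of_neg (by simpa using h) (by simpa using h)

/-- At the scale `2 ^ j` the weight of level `i` decays geometrically in `|i - j|`. -/
lemma psi0_zpow_mul_min_le {t μ : ℝ} (ht : 0 < t) (hμ : 0 ≤ μ) {j : ℤ}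
    (hj : (2 : ℝ) ^ j ≤ t) (hj' : t < 2 ^ (j + 1)) (i : ℤ) :
    psi0 (2 ^ i * μ) * min (t ^ 2 / (2 ^ i) ^ 2) 1 ≤
      4 * psi0 (t * μ) * (7 / 8 : ℝ) ^ (i - j).natAbs := by
  have hjpos : (0 : ℝ) < 2 ^ j := by positivity
  have hmono : psi0 (2 ^ j * μ) ≤ psi0 (t * μ) := psi0_mono (by positivity) (by gcongr)
  have hnn : 0 ≤ psi0 (t * μ) := psi0_nonneg (by positivity)
  have hnn' : 0 ≤ psi0 (2 ^ i * μ) := psi0_nonneg (by positivity)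
  rcases le_total i j with h | h
  · obtain ⟨n, rfl⟩ := Int.exists_add_of_le h
    have habs : (i - (i + n)).natAbs = n := by omega
    rw [habs]
    have h1 := psi0_le_pow_mul (t := 2 ^ i * μ) (by positivity) n
    have h2 : (2 : ℝ) ^ n * (2 ^ i * μ) = 2 ^ (i + n : ℤ) * μ := by
      rw [zpow_add₀ (by norm_num), zpow_natCast]; ring
    rw [h2] at h1
    calc psi0 (2 ^ i * μ) * min (t ^ 2 / (2 ^ i) ^ 2) 1 ≤ psi0 (2 ^ i * μ) * 1 := by
          gcongr; exact min_le_right _ _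
      _ ≤ (7 / 8 : ℝ) ^ n * psi0 (t * μ) := by rw [mul_one]; exact h1.trans (by gcongr)
      _ ≤ _ := by
          have : 0 ≤ (7 / 8 : ℝ) ^ n * psi0 (t * μ) := by positivity
          linarith
  · obtain ⟨n, rfl⟩ := Int.exists_add_of_le h
    have habs : (j + n - j).natAbs = n := by omega
    rw [habs]
    have h1 := psi0_pow_mul_le (t := 2 ^ j * μ) (by positivity) n
    have h2 : (2 : ℝ) ^ (j + n : ℤ) = 2 ^ n * 2 ^ j := by
      rw [zpow_add₀ (by norm_num), zpow_natCast]; ring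
    rw [zpow_add₀ (by norm_num), zpow_one] at hj'
    rw [h2, mul_assoc]
    have h3 : t ^ 2 / (2 ^ n * (2 : ℝ) ^ j) ^ 2 ≤ 4 * (1 / 2 ^ n) ^ 2 := by
      rw [div_le_iff₀ (by positivity)]
      have : 4 * (1 / (2 : ℝ) ^ n) ^ 2 * (2 ^ n * 2 ^ j) ^ 2 = (2 ^ j * 2) ^ 2 := by
        field_simp; norm_num
      rw [this]
      gcongr
    calc psi0 (2 ^ n * (2 ^ j * μ)) * min (t ^ 2 / (2 ^ n * 2 ^ j) ^ 2) 1
        ≤ (2 ^ n * psi0 (t * μ)) * (4 * (1 / 2 ^ n) ^ 2) := by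
          refine mul_le_mul (h1.trans (by gcongr)) ((min_le_left _ _).trans h3)
            (by positivity) (by positivity)
      _ = 4 * psi0 (t * μ) * (1 / 2) ^ n := by rw [one_div_pow (2 : ℝ) n]; field_simp
      _ ≤ _ := by
          refine mul_le_mul_of_nonneg_left ?_ (by positivity)
          exact pow_le_pow_left₀ (by norm_num) (by norm_num) n

lemma exists_sum_psi0_le : ∃ C > (0 : ℝ), ∀ (t μ : ℝ), 0 ≤ t → 0 ≤ μ → ∀ (a : ℤ) (N : ℕ),
    ∑ i ∈ Finset.range N, psi0 (2 ^ (a + i) * μ) * min (t ^ 2 / (2 ^ (a + i)) ^ 2) 1 ≤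
      C * psi0 (t * μ) := by
  have hC : 0 ≤ ∑' i : ℤ, (7 / 8 : ℝ) ^ i.natAbs := tsum_nonneg fun i => by positivity
  refine ⟨4 * (∑' i : ℤ, (7 / 8 : ℝ) ^ i.natAbs) + 1, by positivity, fun t μ ht hμ a N => ?_⟩
  rcases ht.eq_or_lt with rfl | ht
  · simp [psi0]
  obtain ⟨j, hj, hj'⟩ := exists_mem_Ico_zpow ht (one_lt_two (α := ℝ))
  have hnn : 0 ≤ psi0 (t * μ) := psi0_nonneg (by positivity)
  have hinj : Function.Injective fun i : ℕ => a + (i : ℤ) - j := fun x y h => by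
    simp only at h; omega
  have hsum := (summable_pow_natAbs.comp_injective hinj).sum_le_tsum (Finset.range N)
    (fun i _ => by simp only [Function.comp_apply]; positivity)
  have hle := hsum.trans (tsum_comp_le_tsum_of_inj summable_pow_natAbs
    (fun i => by positivity) hinj)
  calc _ ≤ ∑ i ∈ Finset.range N, 4 * psi0 (t * μ) * (7 / 8 : ℝ) ^ (a + i - j).natAbs :=
        Finset.sum_le_sum fun i _ => psi0_zpow_mul_min_le ht hμ hj hj' _
    _ = 4 * psi0 (t * μ) * ∑ i ∈ Finset.range N, (7 / 8 : ℝ) ^ (a + i - j).natAbs := by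
        rw [Finset.mul_sum]
    _ ≤ 4 * psi0 (t * μ) * ∑' i : ℤ, (7 / 8 : ℝ) ^ i.natAbs := by gcongr; exact hle
    _ ≤ _ := by linarith

/-! ### Geometry of the dyadic arcs -/

lemma arcLen_pos (k : ℕ) : 0 < arcLen k := by
  unfold arcLen; positivity

lemma arcLen_succ (k : ℕ) : arcLen (k + 1) = arcLen k / 2 := by
  unfold arcLen; rw [pow_succ]; field_simp

lemma arc_left (δ : ℝ) (k m : ℕ) :
    arc δ (k + 1) (2 * m) = Ico (arcStart δ k m) (arcStart δ k m + arcLen k / 2) := by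
  have h : arcStart δ (k + 1) (2 * m) = arcStart δ k m := by
    unfold arcStart; push_cast; rw [pow_succ]; field_simp
  rw [arc, h, arcLen_succ]

lemma arc_right (δ : ℝ) (k m : ℕ) : arc δ (k + 1) (2 * m + 1) =
    Ico (arcStart δ k m + arcLen k / 2) (arcStart δ k m + arcLen k) := by
  have h : arcStart δ (k + 1) (2 * m + 1) = arcStart δ k m + arcLen k / 2 := by
    unfold arcStart arcLen; push_cast; rw [pow_succ]; field_simp; ring
  rw [arc, h, arcLen_succ]
  congr 1
  ring

lemma arc_eq_union (δ : ℝ) (k m : ℕ) :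
    arc δ k m = arc δ (k + 1) (2 * m) ∪ arc δ (k + 1) (2 * m + 1) := by
  have := arcLen_pos k
  rw [arc_left, arc_right, Ico_union_Ico_eq_Ico (by linarith) (by linarith), arc]

lemma arc_disjoint (δ : ℝ) (k m : ℕ) :
    Disjoint (arc δ (k + 1) (2 * m)) (arc δ (k + 1) (2 * m + 1)) := by
  rw [arc_left, arc_right, Set.disjoint_left]
  rintro x ⟨_, h⟩ ⟨h', _⟩
  linarith

lemma measurableSet_arc (δ : ℝ) (k m : ℕ) : MeasurableSet (arc δ k m) := measurableSet_Ico

lemma volume_arc (δ : ℝ) (k m : ℕ) : volume (arc δ k m) = ENNReal.ofReal (arcLen k) := by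
  rw [arc, Real.volume_Ico]; simp

lemma torus_eq_arc (δ : ℝ) : torus δ = arc δ 0 0 := by
  simp [torus, arc, arcStart, arcLen]

lemma arc_index_lt {δ θ : ℝ} {k m m' : ℕ} (h : θ ∈ arc δ k m) (h' : θ ∈ arc δ k m') :
    m < m' + 1 := by
  have h1 := h.1
  have h2 := h'.2
  unfold arcStart at h1
  unfold arcStart arcLen at h2
  have h3 : 2 * π * ((m : ℝ) / 2 ^ k + δ) < 2 * π * (((m' : ℝ) + 1) / 2 ^ k + δ) := by
    refine h1.trans_lt (h2.trans_eq ?_)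
    ring
  have h4 := lt_of_mul_lt_mul_left h3 (by positivity)
  have h5 : (m : ℝ) / 2 ^ k < ((m' : ℝ) + 1) / 2 ^ k := by linarith
  rw [div_lt_div_iff_of_pos_right (by positivity)] at h5
  exact_mod_cast h5

lemma arc_index_unique {δ θ : ℝ} {k m m' : ℕ} (h : θ ∈ arc δ k m) (h' : θ ∈ arc δ k m') :
    m = m' := by
  have := arc_index_lt h h'
  have := arc_index_lt h' h
  omega

lemma haar_eq (δ : ℝ) (k m : ℕ) (θ : ℝ) : haar δ k m θ = (arcLen k) ^ (-(1 : ℝ) / 2) *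
    ((arc δ (k + 1) (2 * m)).indicator (fun _ => (1 : ℝ)) θ -
      (arc δ (k + 1) (2 * m + 1)).indicator (fun _ => (1 : ℝ)) θ) := by
  rw [arc_left, arc_right, haar]

/-! ### Stopped martingales on the dyadic tree -/

/-- The dyadic martingale on the arc `(k, m)` with initial value `u` and increments `± d`, run
for `n` generations and stopped before it may exceed `lam` in absolute value. -/
def stopped (δ : ℝ) (d : ℕ → ℕ → ℝ) (lam : ℝ) : ℕ → ℕ → ℕ → ℝ → ℝ → ℝ
  | 0, k, m, u => (arc δ k m).indicator (fun _ => u)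
  | n + 1, k, m, u =>
    if lam < |u| + |d k m| then (arc δ k m).indicator (fun _ => u)
    else fun θ => stopped δ d lam n (k + 1) (2 * m) (u + d k m) θ +
      stopped δ d lam n (k + 1) (2 * m + 1) (u - d k m) θ

/-- The total length of the arcs on which `stopped` is stopped. -/
def stopLen (d : ℕ → ℕ → ℝ) (lam : ℝ) : ℕ → ℕ → ℕ → ℝ → ℝ
  | 0, _, _, _ => 0
  | n + 1, k, m, u =>
    if lam < |u| + |d k m| then arcLen k
    else stopLen d lam n (k + 1) (2 * m) (u + d k m) +
      stopLen d lam n (k + 1) (2 * m + 1) (u - d k m)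

/-- The integral over the arc `(k, m)` of `H` applied to `s` plus the sum of the squares of the
next `n` increments. -/
def treeInt (d : ℕ → ℕ → ℝ) (H : ℝ → ℝ) : ℕ → ℕ → ℕ → ℝ → ℝ
  | 0, k, _, s => arcLen k * H s
  | n + 1, k, m, s => treeInt d H n (k + 1) (2 * m) (s + d k m ^ 2) +
      treeInt d H n (k + 1) (2 * m + 1) (s + d k m ^ 2)

section Tree

variable {δ : ℝ} {d : ℕ → ℕ → ℝ} {lam : ℝ}

lemma support_stopped (n k m : ℕ) (u : ℝ) :
    Function.support (stopped δ d lam n k m u) ⊆ arc δ k m := by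
  induction n generalizing k m u with
  | zero => exact support_indicator_subset
  | succ n ih =>
    rw [stopped]
    split_ifs
    · exact support_indicator_subset
    · refine (Function.support_add _ _).trans ?_
      rw [arc_eq_union]
      exact union_subset_union (ih _ _ _) (ih _ _ _)

lemma stopped_eq_zero {n k m : ℕ} {u θ : ℝ} (h : θ ∉ arc δ k m) :
    stopped δ d lam n k m u θ = 0 :=
  Function.notMem_support.1 fun h' => h (support_stopped n k m u h')

lemma measurable_stopped (n k m : ℕ) (u : ℝ) : Measurable (stopped δ d lam n k m u) := by
  induction n generalizing k m u with
  | zero => exact measurable_const.indicator (measurableSet_arc δ k m)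
  | succ n ih =>
    rw [stopped]
    split_ifs
    · exact measurable_const.indicator (measurableSet_arc δ k m)
    · exact (ih _ _ _).add (ih _ _ _)

lemma abs_indicator_const_le (s : Set ℝ) (u θ : ℝ) : |s.indicator (fun _ => u) θ| ≤ |u| := by
  by_cases h : θ ∈ s <;> simp [h]

lemma abs_stopped_le (n k m : ℕ) (u θ : ℝ) :
    |stopped δ d lam n k m u θ| ≤ max lam |u| := by
  induction n generalizing k m u with
  | zero => exact (abs_indicator_const_le _ _ _).trans (le_max_right _ _)
  | succ n ih =>
    rw [stopped]
    split_ifs with h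
    · exact (abs_indicator_const_le _ _ _).trans (le_max_right _ _)
    · rw [not_lt] at h
      have h1 := ih (k + 1) (2 * m) (u + d k m)
      have h2 := ih (k + 1) (2 * m + 1) (u - d k m)
      rw [max_eq_left ((abs_add_le _ _).trans h)] at h1
      rw [max_eq_left ((abs_sub _ _).trans h)] at h2
      refine le_trans ?_ (le_max_left _ _)
      beta_reduce
      by_cases hl : θ ∈ arc δ (k + 1) (2 * m)
      · rw [stopped_eq_zero (disjoint_left.1 (arc_disjoint δ k m) hl), add_zero]
        exact h1
      · rw [stopped_eq_zero hl, zero_add]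
        exact h2

lemma integrable_stopped (n k m : ℕ) (u : ℝ) : Integrable (stopped δ d lam n k m u) := by
  have h : IntegrableOn (stopped δ d lam n k m u) (arc δ k m) := by
    refine Measure.integrableOn_of_bounded (M := max lam |u|) (by simp [volume_arc])
      (measurable_stopped n k m u).aestronglyMeasurable ?_
    exact Filter.Eventually.of_forall fun θ => abs_stopped_le n k m u θ
  rwa [integrableOn_iff_integrable_of_support_subset (support_stopped n k m u)] at h

lemma integral_indicator_arc (k m : ℕ) (u : ℝ) :
    ∫ θ, (arc δ k m).indicator (fun _ => u) θ = arcLen k * u := by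
  rw [integral_indicator_const _ (measurableSet_arc δ k m), measureReal_def, volume_arc,
    ENNReal.toReal_ofReal (arcLen_pos k).le, smul_eq_mul]

lemma integral_stopped (n k m : ℕ) (u : ℝ) :
    ∫ θ, stopped δ d lam n k m u θ = arcLen k * u := by
  induction n generalizing k m u with
  | zero => exact integral_indicator_arc k m u
  | succ n ih =>
    rw [stopped]
    split_ifs with h
    · exact integral_indicator_arc k m u
    · rw [integral_add (integrable_stopped _ _ _ _) (integrable_stopped _ _ _ _), ih, ih,
        arcLen_succ]
      ring

/-- Above a large enough level nothing is stopped. -/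
lemma exists_stopped_eq_sum {r : ℕ → ℝ → ℝ}
    (hl : ∀ k m, m < 2 ^ k → ∀ θ ∈ arc δ (k + 1) (2 * m), r k θ = d k m)
    (hr : ∀ k m, m < 2 ^ k → ∀ θ ∈ arc δ (k + 1) (2 * m + 1), r k θ = -d k m)
    (n k m : ℕ) (u : ℝ) (hm : m < 2 ^ k) : ∃ Λ : ℝ, ∀ lam ≥ Λ, ∀ θ ∈ arc δ k m,
      stopped δ d lam n k m u θ = u + ∑ i ∈ Finset.range n, r (k + i) θ := by
  induction n generalizing k m u with
  | zero => exact ⟨0, fun lam _ θ hθ => by simp [stopped, hθ]⟩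
  | succ n ih =>
    obtain ⟨Λ₁, h₁⟩ := ih (k + 1) (2 * m) (u + d k m) (by rw [pow_succ]; omega)
    obtain ⟨Λ₂, h₂⟩ := ih (k + 1) (2 * m + 1) (u - d k m) (by rw [pow_succ]; omega)
    refine ⟨max (max Λ₁ Λ₂) (|u| + |d k m|), fun lam hlam θ hθ => ?_⟩
    simp only [ge_iff_le, max_le_iff] at hlam
    obtain ⟨⟨hΛ₁, hΛ₂⟩, hΛ⟩ := hlam
    have hshift : ∑ i ∈ Finset.range n, r (k + (i + 1)) θ =
        ∑ i ∈ Finset.range n, r (k + 1 + i) θ :=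
      Finset.sum_congr rfl fun i _ => by rw [add_assoc, add_comm 1 i]
    rw [stopped, if_neg (not_lt.2 hΛ), Finset.sum_range_succ', hshift, add_zero]
    rw [arc_eq_union] at hθ
    rcases hθ with hθ | hθ
    · rw [stopped_eq_zero (disjoint_left.1 (arc_disjoint δ k m) hθ), h₁ lam hΛ₁ θ hθ,
        hl k m hm θ hθ]
      ring
    · rw [stopped_eq_zero (disjoint_right.1 (arc_disjoint δ k m) hθ), h₂ lam hΛ₂ θ hθ,
        hr k m hm θ hθ]
      ring

/-- Below a small enough level the martingale started at `0` is stopped before it moves. -/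
lemma exists_stopped_eq_zero (n k m : ℕ) :
    ∃ ε > 0, ∀ lam, 0 ≤ lam → lam < ε → ∀ θ, stopped δ d lam n k m 0 θ = 0 := by
  induction n generalizing k m with
  | zero => exact ⟨1, one_pos, fun lam _ _ θ => by simp [stopped]⟩
  | succ n ih =>
    by_cases hd : d k m = 0
    · obtain ⟨ε₁, hε₁, h₁⟩ := ih (k + 1) (2 * m)
      obtain ⟨ε₂, hε₂, h₂⟩ := ih (k + 1) (2 * m + 1)
      refine ⟨min ε₁ ε₂, lt_min hε₁ hε₂, fun lam h0 hlam θ => ?_⟩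
      rw [lt_min_iff] at hlam
      rw [stopped, if_neg (by simpa [hd] using h0)]
      simp [hd, h₁ lam h0 hlam.1, h₂ lam h0 hlam.2]
    · refine ⟨|d k m|, abs_pos.2 hd, fun lam h0 hlam θ => ?_⟩
      rw [stopped, if_pos (by simpa using hlam)]
      simp

/-! ### The good-`λ` estimate -/

lemma stopLen_le (n k m : ℕ) (u : ℝ) : stopLen d lam n k m u ≤ arcLen k := by
  induction n generalizing k m u with
  | zero => exact (arcLen_pos k).le
  | succ n ih =>
    rw [stopLen]
    split_ifs
    · exact le_rfl
    · have h1 := ih (k + 1) (2 * m) (u + d k m)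
      have h2 := ih (k + 1) (2 * m + 1) (u - d k m)
      rw [arcLen_succ] at h1 h2
      linarith

lemma le_treeInt_min (c : ℝ) (n k m : ℕ) (s : ℝ) :
    arcLen k * min s c ≤ treeInt d (fun x => min x c) n k m s := by
  induction n generalizing k m s with
  | zero => exact le_rfl
  | succ n ih =>
    have h1 := ih (k + 1) (2 * m) (s + d k m ^ 2)
    have h2 := ih (k + 1) (2 * m + 1) (s + d k m ^ 2)
    have h3 : min s c ≤ min (s + d k m ^ 2) c :=
      min_le_min_right _ (le_add_of_nonneg_right (sq_nonneg _))
    have h4 := mul_le_mul_of_nonneg_left h3 (arcLen_pos k).le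
    rw [arcLen_succ] at h1 h2
    rw [treeInt]
    linarith

lemma sq_mul_stopLen_le (hlam : 0 ≤ lam) (n k m : ℕ) (u s : ℝ) (hs : 0 ≤ s)
    (hs' : s ≤ lam ^ 2) : lam ^ 2 * stopLen d lam n k m u ≤
      arcLen k * (2 * u ^ 2 - 2 * s) + 3 * treeInt d (fun x => min x (lam ^ 2)) n k m s := by
  induction n generalizing k m u s with
  | zero =>
    have := arcLen_pos k
    rw [stopLen, treeInt, min_eq_left hs', mul_zero]
    have : 0 ≤ arcLen k * (2 * u ^ 2 + s) := by positivity
    linarith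
  | succ n ih =>
    have hL := arcLen_pos k
    have h1 := le_treeInt_min (d := d) (lam ^ 2) n (k + 1) (2 * m) (s + d k m ^ 2)
    have h2 := le_treeInt_min (d := d) (lam ^ 2) n (k + 1) (2 * m + 1) (s + d k m ^ 2)
    rw [arcLen_succ] at h1 h2
    by_cases hbig : lam ^ 2 < s + d k m ^ 2
    · rw [min_eq_right hbig.le] at h1 h2
      have h3 := mul_le_mul_of_nonneg_left (stopLen_le (d := d) (lam := lam) (n + 1) k m u)
        (sq_nonneg lam)
      have h4 : 0 ≤ arcLen k * (2 * u ^ 2 + 2 * (lam ^ 2 - s)) :=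
        mul_nonneg hL.le (by nlinarith [sq_nonneg u])
      rw [treeInt]
      linarith
    · rw [not_lt] at hbig
      rw [min_eq_left hbig] at h1 h2
      rw [stopLen, treeInt]
      split_ifs with h
      · have h3 : lam ^ 2 ≤ 2 * u ^ 2 + 2 * d k m ^ 2 := by
          have := pow_le_pow_left₀ hlam h.le 2
          nlinarith [sq_nonneg (|u| - |d k m|), sq_abs u, sq_abs (d k m)]
        have h4 : 0 ≤ arcLen k * (2 * u ^ 2 + 2 * d k m ^ 2 - lam ^ 2 + (s + d k m ^ 2)) :=
          mul_nonneg hL.le (by nlinarith [sq_nonneg (d k m)])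
        linarith
      · have h3 := ih (k + 1) (2 * m) (u + d k m) (s + d k m ^ 2) (by positivity) hbig
        have h4 := ih (k + 1) (2 * m + 1) (u - d k m) (s + d k m ^ 2) (by positivity) hbig
        rw [arcLen_succ] at h3 h4
        linarith

lemma treeInt_mono {H H' : ℝ → ℝ} (hH : ∀ s, 0 ≤ s → H s ≤ H' s) (n k m : ℕ) (s : ℝ)
    (hs : 0 ≤ s) : treeInt d H n k m s ≤ treeInt d H' n k m s := by
  induction n generalizing k m s with
  | zero => exact mul_le_mul_of_nonneg_left (hH s hs) (arcLen_pos k).le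
  | succ n ih => exact add_le_add (ih _ _ _ (by positivity)) (ih _ _ _ (by positivity))

lemma treeInt_nonneg {H : ℝ → ℝ} (hH : ∀ s, 0 ≤ s → 0 ≤ H s) (n k m : ℕ) (s : ℝ)
    (hs : 0 ≤ s) : 0 ≤ treeInt d H n k m s := by
  induction n generalizing k m s with
  | zero => exact mul_nonneg (arcLen_pos k).le (hH s hs)
  | succ n ih => exact add_nonneg (ih _ _ _ (by positivity)) (ih _ _ _ (by positivity))

lemma treeInt_const_mul (c : ℝ) (H : ℝ → ℝ) (n k m : ℕ) (s : ℝ) :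
    treeInt d (fun x => c * H x) n k m s = c * treeInt d H n k m s := by
  induction n generalizing k m s with
  | zero => simp only [treeInt]; ring
  | succ n ih => rw [treeInt, treeInt, ih, ih]; ring

lemma treeInt_sum {ι : Type*} (F : Finset ι) (H : ι → ℝ → ℝ) (n k m : ℕ) (s : ℝ) :
    treeInt d (fun x => ∑ i ∈ F, H i x) n k m s = ∑ i ∈ F, treeInt d (H i) n k m s := by
  induction n generalizing k m s with
  | zero => simp only [treeInt, Finset.mul_sum]
  | succ n ih => simp only [treeInt, ih, Finset.sum_add_distrib]

lemma lintegral_eq_treeInt {H : ℝ → ℝ} (hH : ∀ s, 0 ≤ s → 0 ≤ H s) {q : ℕ → ℝ → ℝ}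
    (hq : ∀ k m, m < 2 ^ k → ∀ θ ∈ arc δ k m, q k θ = d k m ^ 2) {G : ℝ → ℝ≥0∞}
    (n k m : ℕ) (s : ℝ) (hs : 0 ≤ s) (hm : m < 2 ^ k)
    (hG : ∀ θ ∈ arc δ k m,
      G θ = ENNReal.ofReal (H (s + ∑ i ∈ Finset.range n, q (k + i) θ))) :
    ∫⁻ θ in arc δ k m, G θ = ENNReal.ofReal (treeInt d H n k m s) := by
  induction n generalizing k m s with
  | zero =>
    rw [setLIntegral_congr_fun (measurableSet_arc δ k m) hG, treeInt,
      ENNReal.ofReal_mul (arcLen_pos k).le]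
    simp [volume_arc, mul_comm]
  | succ n ih =>
    have hstep : ∀ θ ∈ arc δ k m, G θ =
        ENNReal.ofReal (H (s + d k m ^ 2 + ∑ i ∈ Finset.range n, q (k + 1 + i) θ)) := by
      intro θ hθ
      rw [hG θ hθ, Finset.sum_range_succ', add_zero, hq k m hm θ hθ, add_assoc,
        add_comm (d k m ^ 2)]
      simp only [add_assoc, add_comm 1]
    have hs2 : 0 ≤ s + d k m ^ 2 := by positivity
    rw [treeInt, ENNReal.ofReal_add (treeInt_nonneg hH _ _ _ _ hs2)
      (treeInt_nonneg hH _ _ _ _ hs2), ← ih (k + 1) (2 * m) _ hs2 (by rw [pow_succ]; omega),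
      ← ih (k + 1) (2 * m + 1) _ hs2 (by rw [pow_succ]; omega), ← lintegral_union
      (measurableSet_arc _ _ _) (arc_disjoint δ k m), ← arc_eq_union]
    · exact fun θ hθ => hstep θ (by rw [arc_eq_union]; exact Or.inr hθ)
    · exact fun θ hθ => hstep θ (by rw [arc_eq_union]; exact Or.inl hθ)

/-! ### Atoms -/

/-- `a = (k, m, β)` consists of a dyadic arc `(k, m)` and a mean zero function `β` supported in
it and bounded by `B`. -/
structure IsArcAtom (δ B : ℝ) (a : ℕ × ℕ × (ℝ → ℝ)) : Prop where
  index_lt : a.2.1 < 2 ^ a.1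
  measurable : Measurable a.2.2
  support_subset : Function.support a.2.2 ⊆ arc δ a.1 a.2.1
  abs_le : ∀ θ, |a.2.2 θ| ≤ B
  integral_eq : ∫ θ in arc δ a.1 a.2.1, a.2.2 θ = 0

lemma IsArcAtom.einfNorm_le {B : ℝ} {a : ℕ × ℕ × (ℝ → ℝ)} (ha : IsArcAtom δ B a) :
    einfNorm a.2.2 ≤ ENNReal.ofReal B := by
  refine essSup_le_of_ae_le _ (Filter.Eventually.of_forall fun θ => ?_)
  change ‖a.2.2 θ‖ₑ ≤ _
  rw [← ofReal_norm]
  exact ENNReal.ofReal_le_ofReal (ha.abs_le θ)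

lemma IsArcAtom.einfNorm_toReal_le {B : ℝ} (hB : 0 ≤ B) {a : ℕ × ℕ × (ℝ → ℝ)}
    (ha : IsArcAtom δ B a) : (einfNorm a.2.2).toReal ≤ B :=
  ENNReal.toReal_le_of_le_ofReal hB ha.einfNorm_le

/-- The difference of two consecutive stopped martingales is a sum of atoms. -/
lemma exists_atoms_level (hlam : 0 ≤ lam) (n k m : ℕ) (u : ℝ) (hu : |u| ≤ lam)
    (hm : m < 2 ^ k) : ∃ L : List (ℕ × ℕ × (ℝ → ℝ)),
      (∀ a ∈ L, IsArcAtom δ (3 * lam) a) ∧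
      (∀ θ, (L.map fun a => a.2.2 θ).sum =
        stopped δ d (2 * lam) n k m u θ - stopped δ d lam n k m u θ) ∧
      (L.map fun a => arcLen a.1).sum = stopLen d lam n k m u := by
  induction n generalizing k m u with
  | zero => exact ⟨[], by simp, by simp [stopped], by simp [stopLen]⟩
  | succ n ih =>
    by_cases h : lam < |u| + |d k m|
    · refine ⟨[(k, m, fun θ => stopped δ d (2 * lam) (n + 1) k m u θ -
        (arc δ k m).indicator (fun _ => u) θ)], ?_, ?_, ?_⟩
      · simp only [List.mem_singleton, forall_eq]
        have hsupp : Function.support (fun θ => stopped δ d (2 * lam) (n + 1) k m u θ -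
            (arc δ k m).indicator (fun _ => u) θ) ⊆ arc δ k m :=
          (Function.support_sub _ _).trans
            (union_subset (support_stopped _ _ _ _) support_indicator_subset)
        refine ⟨hm, ?_, hsupp, fun θ => ?_, ?_⟩
        · exact (measurable_stopped _ _ _ _).sub
            (measurable_const.indicator (measurableSet_arc δ k m))
        · have h1 := abs_stopped_le (δ := δ) (d := d) (lam := 2 * lam) (n + 1) k m u θ
          rw [max_eq_left (by linarith)] at h1
          have h2 := abs_indicator_const_le (arc δ k m) u θ
          exact (abs_sub _ _).trans (by linarith)
        · rw [setIntegral_eq_integral_of_forall_compl_eq_zero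
            (fun θ hθ => Function.notMem_support.1 fun h' => hθ (hsupp h')),
            integral_sub (integrable_stopped _ _ _ _) ?_, integral_stopped,
            integral_indicator_arc, sub_self]
          exact (integrable_indicator_iff (measurableSet_arc δ k m)).2
            (integrableOn_const (by simp [volume_arc]))
      · intro θ
        have : stopped δ d lam (n + 1) k m u = (arc δ k m).indicator (fun _ => u) := by
          rw [stopped, if_pos h]
        simp [this]
      · simp [stopLen, h]
    · have h' := not_lt.1 h
      obtain ⟨L₁, ha₁, hs₁, hl₁⟩ := ih (k + 1) (2 * m) (u + d k m)
        ((abs_add_le _ _).trans h') (by rw [pow_succ]; omega)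
      obtain ⟨L₂, ha₂, hs₂, hl₂⟩ := ih (k + 1) (2 * m + 1) (u - d k m)
        ((abs_sub _ _).trans h') (by rw [pow_succ]; omega)
      refine ⟨L₁ ++ L₂, ?_, fun θ => ?_, ?_⟩
      · intro a ha
        rcases List.mem_append.1 ha with ha | ha
        exacts [ha₁ a ha, ha₂ a ha]
      · rw [List.map_append, List.sum_append, hs₁, hs₂, stopped, stopped, if_neg h,
          if_neg (by linarith)]
        ring
      · rw [List.map_append, List.sum_append, hl₁, hl₂, stopLen, if_neg h]

lemma exists_atoms (n : ℕ) (a : ℤ) (N : ℕ) : ∃ L : List (ℕ × ℕ × (ℝ → ℝ)),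
      (∀ b ∈ L, ∃ B, IsArcAtom δ B b) ∧
      (∀ θ, (L.map fun b => b.2.2 θ).sum =
        stopped δ d (2 ^ (a + N)) n 0 0 0 θ - stopped δ d (2 ^ a) n 0 0 0 θ) ∧
      ∀ μ : ℝ, 0 < μ → (L.map fun b => arcLen b.1 * psi0 ((einfNorm b.2.2).toReal / μ)).sum ≤
        ∑ i ∈ Finset.range N,
          stopLen d (2 ^ (a + i)) n 0 0 0 * psi0 (3 * 2 ^ (a + i) / μ) := by
  induction N with
  | zero => exact ⟨[], by simp, by simp, by simp⟩
  | succ N ih =>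
    obtain ⟨L₁, ha₁, hs₁, hl₁⟩ := ih
    obtain ⟨L₂, ha₂, hs₂, hl₂⟩ := exists_atoms_level (δ := δ) (d := d)
      (lam := 2 ^ (a + N : ℤ)) (by positivity) n 0 0 0 (by simp; positivity) (by simp)
    refine ⟨L₁ ++ L₂, ?_, fun θ => ?_, fun μ hμ => ?_⟩
    · intro b hb
      rcases List.mem_append.1 hb with hb | hb
      exacts [ha₁ b hb, ⟨_, ha₂ b hb⟩]
    · have hpow : (2 : ℝ) ^ (a + (N + 1 : ℕ) : ℤ) = 2 * 2 ^ (a + N : ℤ) := by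
        push_cast
        rw [← add_assoc, zpow_add_one₀ (by norm_num), mul_comm]
      rw [List.map_append, List.sum_append, hs₁, hs₂, hpow]
      ring
    · rw [List.map_append, List.sum_append, Finset.sum_range_succ, ← hl₂,
        ← List.sum_map_mul_right]
      refine add_le_add (hl₁ μ hμ) (List.sum_le_sum fun b hb => ?_)
      refine mul_le_mul_of_nonneg_left (psi0_mono (by positivity) ?_) (arcLen_pos _).le
      gcongr
      exact (ha₂ b hb).einfNorm_toReal_le (by positivity)

end Tree

/-- Comparison of the atomic modular with the modular of the square function. -/
lemma exists_sum_stopLen_le : ∃ C > (0 : ℝ), ∀ (d : ℕ → ℕ → ℝ) (n : ℕ) (lam : ℝ), 0 < lam →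
    treeInt d (fun s => psi0 (√s / lam)) n 0 0 0 ≤ 2 * π → ∀ (a : ℤ) (N : ℕ),
      ∑ i ∈ Finset.range N,
        stopLen d (2 ^ (a + i)) n 0 0 0 * psi0 (3 * 2 ^ (a + i) / (C * lam)) ≤ 1 := by
  obtain ⟨C, hC, hsum⟩ := exists_sum_psi0_le
  obtain ⟨M, hM⟩ := exists_pow_lt_of_lt_one (x := 1 / (3 * (C * (2 * π)))) (by positivity)
    (show (7 / 8 : ℝ) < 1 by norm_num)
  rw [lt_div_iff₀ (by positivity)] at hM
  refine ⟨3 * 2 ^ M, by positivity, fun d n lam hlam hint a N => ?_⟩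
  have hterm : ∀ i : ℕ,
      stopLen d (2 ^ (a + i : ℤ)) n 0 0 0 * psi0 (3 * 2 ^ (a + i : ℤ) / (3 * 2 ^ M * lam)) ≤
      3 * (7 / 8 : ℝ) ^ M * treeInt d (fun s => psi0 (2 ^ (a + i : ℤ) * lam⁻¹) *
        min (√s ^ 2 / (2 ^ (a + i : ℤ)) ^ 2) 1) n 0 0 0 := by
    intro i
    generalize hv : (2 : ℝ) ^ (a + i : ℤ) = v
    have hv0 : 0 < v := by rw [← hv]; positivity
    have h1 := sq_mul_stopLen_le (d := d) hv0.le n 0 0 0 0 le_rfl (by positivity)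
    have h2 : psi0 (3 * v / (3 * 2 ^ M * lam)) ≤ (7 / 8 : ℝ) ^ M * psi0 (v * lam⁻¹) := by
      refine (psi0_le_pow_mul (by positivity) M).trans (le_of_eq ?_)
      congr 2
      field_simp
    have h3 : stopLen d v n 0 0 0 ≤
        3 * ((v ^ 2)⁻¹ * treeInt d (fun x => min x (v ^ 2)) n 0 0 0) := by
      rw [← mul_le_mul_iff_right₀ (show 0 < v ^ 2 by positivity)]
      refine h1.trans (le_of_eq ?_)
      field_simp
      ring
    rw [← treeInt_const_mul] at h3
    have h4 : treeInt d (fun x => (v ^ 2)⁻¹ * min x (v ^ 2)) n 0 0 0 ≤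
        treeInt d (fun s => min (√s ^ 2 / v ^ 2) 1) n 0 0 0 := by
      refine treeInt_mono (fun s hs => le_of_eq ?_) _ _ _ _ le_rfl
      rw [Real.sq_sqrt hs, mul_min_of_nonneg _ _ (by positivity),
        inv_mul_cancel₀ (by positivity), div_eq_inv_mul]
    have h5 : 0 ≤ treeInt d (fun s => min (√s ^ 2 / v ^ 2) 1) n 0 0 0 :=
      treeInt_nonneg (fun s hs => by positivity) _ _ _ _ le_rfl
    rw [treeInt_const_mul]
    calc _ ≤ (3 * treeInt d (fun s => min (√s ^ 2 / v ^ 2) 1) n 0 0 0) *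
          ((7 / 8 : ℝ) ^ M * psi0 (v * lam⁻¹)) :=
          mul_le_mul (h3.trans (by gcongr)) h2 (psi0_nonneg (by positivity)) (by positivity)
      _ = _ := by ring
  calc _ ≤ ∑ i ∈ Finset.range N, 3 * (7 / 8 : ℝ) ^ M *
        treeInt d (fun s => psi0 (2 ^ (a + i : ℤ) * lam⁻¹) *
          min (√s ^ 2 / (2 ^ (a + i : ℤ)) ^ 2) 1) n 0 0 0 := Finset.sum_le_sum fun i _ => hterm i
    _ = 3 * (7 / 8 : ℝ) ^ M * treeInt d (fun s => ∑ i ∈ Finset.range N,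
          psi0 (2 ^ (a + i : ℤ) * lam⁻¹) * min (√s ^ 2 / (2 ^ (a + i : ℤ)) ^ 2) 1) n 0 0 0 := by
        rw [treeInt_sum, Finset.mul_sum]
    _ ≤ 3 * (7 / 8 : ℝ) ^ M * treeInt d (fun s => C * psi0 (√s / lam)) n 0 0 0 := by
        gcongr
        refine treeInt_mono (fun s _ => ?_) _ _ _ _ le_rfl
        exact hsum _ _ (Real.sqrt_nonneg s) (by positivity) a N
    _ = 3 * (7 / 8 : ℝ) ^ M * (C * treeInt d (fun s => psi0 (√s / lam)) n 0 0 0) := by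
        rw [treeInt_const_mul]
    _ ≤ 3 * (7 / 8 : ℝ) ^ M * (C * (2 * π)) := by gcongr
    _ ≤ 1 := by linarith

/-! ### Finite Haar expansions -/

/-- The normalised Haar coefficient `⟨f, h_I⟩ |I|^{-1/2}`. -/
def haarAmp (δ : ℝ) (f : ℝ → ℝ) (k m : ℕ) : ℝ :=
  haarCoeff δ k m f * (arcLen k) ^ (-(1 : ℝ) / 2)

lemma sum_haar_left {δ : ℝ} {f : ℝ → ℝ} {k m : ℕ} (hm : m < 2 ^ k) {θ : ℝ}
    (hθ : θ ∈ arc δ (k + 1) (2 * m)) :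
    ∑ i : Fin (2 ^ k), haarCoeff δ k i f * haar δ k i θ = haarAmp δ f k m := by
  have hθ' : θ ∈ arc δ k m := by rw [arc_eq_union]; exact Or.inl hθ
  rw [Finset.sum_eq_single ⟨m, hm⟩ ?_ (by simp)]
  · rw [haar_eq, indicator_of_mem hθ,
      indicator_of_notMem (disjoint_left.1 (arc_disjoint δ k m) hθ), haarAmp]
    ring
  · intro i _ hi
    have hni : θ ∉ arc δ k i := fun h => hi (Fin.ext (arc_index_unique h hθ'))
    rw [arc_eq_union, mem_union, not_or] at hni
    rw [haar_eq, indicator_of_notMem hni.1, indicator_of_notMem hni.2]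
    ring

lemma sum_haar_right {δ : ℝ} {f : ℝ → ℝ} {k m : ℕ} (hm : m < 2 ^ k) {θ : ℝ}
    (hθ : θ ∈ arc δ (k + 1) (2 * m + 1)) :
    ∑ i : Fin (2 ^ k), haarCoeff δ k i f * haar δ k i θ = -haarAmp δ f k m := by
  have hθ' : θ ∈ arc δ k m := by rw [arc_eq_union]; exact Or.inr hθ
  rw [Finset.sum_eq_single ⟨m, hm⟩ ?_ (by simp)]
  · rw [haar_eq, indicator_of_mem hθ,
      indicator_of_notMem (disjoint_right.1 (arc_disjoint δ k m) hθ), haarAmp]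
    ring
  · intro i _ hi
    have hni : θ ∉ arc δ k i := fun h => hi (Fin.ext (arc_index_unique h hθ'))
    rw [arc_eq_union, mem_union, not_or] at hni
    rw [haar_eq, indicator_of_notMem hni.1, indicator_of_notMem hni.2]
    ring

/-- The contribution of the `k`-th generation to the squared square function. -/
def sqLevel (δ : ℝ) (f : ℝ → ℝ) (k : ℕ) (θ : ℝ) : ℝ :=
  ∑ i : Fin (2 ^ k), (arc δ k i).indicator (fun _ => haarAmp δ f k i ^ 2) θ

lemma sqLevel_nonneg (δ : ℝ) (f : ℝ → ℝ) (k : ℕ) (θ : ℝ) : 0 ≤ sqLevel δ f k θ :=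
  Finset.sum_nonneg fun _ _ => indicator_nonneg (fun _ _ => sq_nonneg _) _

lemma sqLevel_of_mem {δ : ℝ} {f : ℝ → ℝ} {k m : ℕ} (hm : m < 2 ^ k) {θ : ℝ}
    (hθ : θ ∈ arc δ k m) : sqLevel δ f k θ = haarAmp δ f k m ^ 2 := by
  rw [sqLevel, Finset.sum_eq_single ⟨m, hm⟩ ?_ (by simp)]
  · rw [indicator_of_mem hθ]
  · exact fun i _ hi => indicator_of_notMem
      (fun h => hi (Fin.ext (arc_index_unique h hθ))) _

lemma haarAmp_sq (δ : ℝ) (f : ℝ → ℝ) (k m : ℕ) :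
    haarAmp δ f k m ^ 2 = haarCoeff δ k m f ^ 2 * (arcLen k)⁻¹ := by
  rw [haarAmp, mul_pow, ← Real.rpow_natCast ((arcLen k) ^ _), ← Real.rpow_mul (arcLen_pos k).le,
    ← Real.rpow_neg_one]
  norm_num

lemma ofReal_sqLevel (δ : ℝ) (f : ℝ → ℝ) (k : ℕ) (θ : ℝ) :
    ENNReal.ofReal (sqLevel δ f k θ) = ∑' m : Fin (2 ^ k),
      (‖haarCoeff δ k m f‖₊ : ℝ≥0∞) ^ 2 *
        (arc δ k m).indicator (fun _ => (ENNReal.ofReal (arcLen k))⁻¹) θ := by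
  rw [tsum_fintype, sqLevel, ENNReal.ofReal_sum_of_nonneg
    fun _ _ => indicator_nonneg (fun _ _ => sq_nonneg _) _]
  refine Finset.sum_congr rfl fun i _ => ?_
  by_cases h : θ ∈ arc δ k i
  · rw [indicator_of_mem h, indicator_of_mem h, haarAmp_sq,
      ENNReal.ofReal_mul (sq_nonneg _), ENNReal.ofReal_inv_of_pos (arcLen_pos k), ← sq_abs,
      ENNReal.ofReal_pow (abs_nonneg _), ← Real.norm_eq_abs, ofReal_norm]
    rfl
  · simp [h]

lemma sqFn_eq {δ : ℝ} {f : ℝ → ℝ} {K : ℕ}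
    (hK : ∀ k m, K ≤ k → m < 2 ^ k → haarCoeff δ k m f = 0) (θ : ℝ) :
    sqFn δ f θ = ENNReal.ofReal (√(∑ i ∈ Finset.range K, sqLevel δ f i θ)) := by
  have hzero : ∀ k ∉ Finset.range K, ENNReal.ofReal (sqLevel δ f k θ) = 0 := by
    intro k hk
    rw [Finset.mem_range, not_lt] at hk
    rw [ENNReal.ofReal_eq_zero, sqLevel]
    refine (Finset.sum_eq_zero fun i _ => ?_).le
    simp [haarAmp, hK k i hk i.2]
  rw [sqFn]
  simp_rw [← ofReal_sqLevel]
  rw [tsum_eq_sum hzero, ← ENNReal.ofReal_sum_of_nonneg fun i _ => sqLevel_nonneg δ f i θ,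
    Real.sqrt_eq_rpow, ENNReal.ofReal_rpow_of_nonneg
      (Finset.sum_nonneg fun i _ => sqLevel_nonneg δ f i θ) (by norm_num)]

lemma lintegral_psi0E_sqFn {δ : ℝ} {f : ℝ → ℝ} {K : ℕ}
    (hK : ∀ k m, K ≤ k → m < 2 ^ k → haarCoeff δ k m f = 0) {lam : ℝ} (hlam : 0 < lam) :
    ∫⁻ θ in torus δ, psi0E ((ENNReal.ofReal lam)⁻¹ * sqFn δ f θ) =
      ENNReal.ofReal (treeInt (haarAmp δ f) (fun s => psi0 (√s / lam)) K 0 0 0) := by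
  rw [torus_eq_arc]
  refine lintegral_eq_treeInt (q := sqLevel δ f) (fun s _ => psi0_nonneg (by positivity))
    (fun k m hm θ hθ => sqLevel_of_mem hm hθ) K 0 0 0 le_rfl (by simp) fun θ _ => ?_
  rw [sqFn_eq hK, ← ENNReal.ofReal_inv_of_pos hlam, ← ENNReal.ofReal_mul (by positivity),
    psi0E_ofReal (by positivity)]
  simp only [zero_add, div_eq_inv_mul]

lemma exists_coeff_eq_zero {δ : ℝ} {f : ℝ → ℝ}
    (hfin : {p : ℕ × ℕ | p.2 < 2 ^ p.1 ∧ haarCoeff δ p.1 p.2 f ≠ 0}.Finite) :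
    ∃ K, ∀ k m, K ≤ k → m < 2 ^ k → haarCoeff δ k m f = 0 := by
  obtain ⟨K, hK⟩ := (hfin.image Prod.fst).bddAbove
  refine ⟨K + 1, fun k m hk hm => ?_⟩
  by_contra h
  have : k ≤ K := hK ⟨(k, m), ⟨hm, h⟩, rfl⟩
  omega

lemma exists_levels {ε : ℝ} (hε : 0 < ε) (Λ : ℝ) :
    ∃ (a : ℤ) (N : ℕ), (2 : ℝ) ^ a < ε ∧ Λ ≤ 2 ^ (a + N) := by
  obtain ⟨p, hp⟩ := exists_pow_lt_of_lt_one hε (show (1 / 2 : ℝ) < 1 by norm_num)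
  obtain ⟨q, hq⟩ := pow_unbounded_of_one_lt Λ (one_lt_two (α := ℝ))
  refine ⟨-p, p + q, ?_, ?_⟩
  · simpa using hp
  · push_cast
    rw [neg_add_cancel_left, zpow_natCast]
    exact hq.le


/-- Atomic decomposition of functions with finite Haar expansion: there is an absolute
constant `C₀ > 0` such that every mean-zero `f` with finite Haar expansion can be written
as a finite sum of multiples of dyadic `H^log` atoms whose atomic Luxemburg norm is
controlled by `C₀` times the Luxemburg norm of the dyadic square function of `f`. -/
theorem stmt11 :
    ∃ C₀ > (0 : ℝ), ∀ (δ : ℝ), 0 ≤ δ → δ < 1 → ∀ f : ℝ → ℝ,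
      Measurable f → IntegrableOn f (torus δ) →
      (∫ θ in torus δ, f θ) = 0 →
      {p : ℕ × ℕ | p.2 < 2 ^ p.1 ∧ haarCoeff δ p.1 p.2 f ≠ 0}.Finite →
      (∀ᵐ θ ∂(volume.restrict (torus δ)),
        f θ = ∑' (k : ℕ) (m : Fin (2 ^ k)), haarCoeff δ k m f * haar δ k m θ) →
      ∃ (N : ℕ) (β : Fin N → ℝ → ℝ) (ks ms : Fin N → ℕ),
        (∀ j, ms j < 2 ^ ks j) ∧
        (∀ j, Measurable (β j)) ∧
        (∀ j, Function.support (β j) ⊆ arc δ (ks j) (ms j)) ∧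
        (∀ j, einfNorm (β j) < ⊤) ∧
        (∀ j, (∫ θ in arc δ (ks j) (ms j), β j θ) = 0) ∧
        (∀ᵐ θ ∂(volume.restrict (torus δ)), f θ = ∑ j, β j θ) ∧
        sInf {lam : ℝ | 0 < lam ∧
            (∑ j, arcLen (ks j) * psi0 ((einfNorm (β j)).toReal / lam)) ≤ 1} ≤
          C₀ * sInf {lam : ℝ | 0 < lam ∧
            (∫⁻ θ in torus δ, psi0E ((ENNReal.ofReal lam)⁻¹ * sqFn δ f θ)) ≤
              ENNReal.ofReal (2 * π)} := by
  obtain ⟨C, hC, hmod⟩ := exists_sum_stopLen_le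
  refine ⟨C, hC, fun δ _ _ f _ _ _ hfin hexp => ?_⟩
  obtain ⟨K, hK⟩ := exists_coeff_eq_zero hfin
  set d := haarAmp δ f
  set r : ℕ → ℝ → ℝ := fun k θ => ∑ i : Fin (2 ^ k), haarCoeff δ k i f * haar δ k i θ
  obtain ⟨Λ, hΛ⟩ := exists_stopped_eq_sum (δ := δ) (d := d) (r := r)
    (fun k m hm θ hθ => sum_haar_left hm hθ) (fun k m hm θ hθ => sum_haar_right hm hθ)
    K 0 0 0 (by simp)
  obtain ⟨ε, hε, hzero⟩ := exists_stopped_eq_zero (δ := δ) (d := d) K 0 0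
  obtain ⟨a, N, ha, hN⟩ := exists_levels hε Λ
  obtain ⟨L, hatom, hsum, hcost⟩ := exists_atoms (δ := δ) (d := d) K a N
  refine ⟨L.length, fun j => L[j].2.2, fun j => L[j].1, fun j => L[j].2.1, ?_, ?_, ?_, ?_, ?_,
    ?_, ?_⟩
  · intro j
    obtain ⟨B, hB⟩ := hatom L[j] (List.getElem_mem _)
    exact hB.index_lt
  · intro j
    obtain ⟨B, hB⟩ := hatom L[j] (List.getElem_mem _)
    exact hB.measurable
  · intro j
    obtain ⟨B, hB⟩ := hatom L[j] (List.getElem_mem _)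
    exact hB.support_subset
  · intro j
    obtain ⟨B, hB⟩ := hatom L[j] (List.getElem_mem _)
    exact hB.einfNorm_le.trans_lt ENNReal.ofReal_lt_top
  · intro j
    obtain ⟨B, hB⟩ := hatom L[j] (List.getElem_mem _)
    exact hB.integral_eq
  · filter_upwards [hexp, ae_restrict_mem measurableSet_Ico] with θ hθ hmem
    have hmem' : θ ∈ arc δ 0 0 := by rw [← torus_eq_arc]; exact hmem
    have hL := Fin.sum_univ_fun_getElem L fun b => b.2.2 θ
    simp only [Fin.getElem_fin]
    rw [hL, hsum, hzero _ (by positivity) ha, hΛ _ hN θ hmem', hθ]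
    simp only [tsum_fintype, zero_add, sub_zero]
    refine tsum_eq_sum fun k hk => Finset.sum_eq_zero fun i _ => ?_
    rw [Finset.mem_range, not_lt] at hk
    rw [hK k i hk i.2, zero_mul]
  · have hL := fun μ : ℝ => Fin.sum_univ_fun_getElem L
      fun b => arcLen b.1 * psi0 ((einfNorm b.2.2).toReal / μ)
    simp only [Fin.getElem_fin, hL]
    rw [← div_le_iff₀' hC]
    refine le_csInf ?_ ?_
    · have hT : 0 ≤ treeInt d (fun s => √s) K 0 0 0 :=
        treeInt_nonneg (fun s _ => Real.sqrt_nonneg s) _ _ _ _ le_rfl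
      refine ⟨treeInt d (fun s => √s) K 0 0 0 + 1, by positivity, ?_⟩
      rw [lintegral_psi0E_sqFn hK (by positivity)]
      refine ENNReal.ofReal_le_ofReal ?_
      have hle : treeInt d (fun s => psi0 (√s / (treeInt d (fun s => √s) K 0 0 0 + 1))) K 0 0 0 ≤
          (treeInt d (fun s => √s) K 0 0 0 + 1)⁻¹ * treeInt d (fun s => √s) K 0 0 0 := by
        rw [← treeInt_const_mul]
        refine treeInt_mono (fun s _ => ?_) _ _ _ _ le_rfl
        exact (psi0_le_self (by positivity)).trans (div_eq_inv_mul _ _).le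
      have hone : (treeInt d (fun s => √s) K 0 0 0 + 1)⁻¹ * treeInt d (fun s => √s) K 0 0 0 ≤ 1 := by
        rw [inv_mul_le_iff₀ (by positivity)]
        linarith
      linarith [Real.pi_gt_three]
    · rintro lam ⟨hlam, hle⟩
      rw [lintegral_psi0E_sqFn hK hlam, ENNReal.ofReal_le_ofReal_iff (by positivity)] at hle
      rw [div_le_iff₀' hC]
      refine csInf_le ⟨0, fun x hx => hx.1.le⟩ ⟨by positivity, ?_⟩
      exact (hcost _ (by positivity)).trans (hmod d K lam hlam hle a N)

end
end
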